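/- For every graph G, G is provable in SGS if and only if G is provable in GS. -/

import Mathlib

namespace GSP

/-- Atoms: a propositional variable (coded by a natural number) with a polarity. -/
abbrev Atom := ℕ × Bool

/-- The dual atom. -/
def dualAtom (a : Atom) : Atom := (a.1, !a.2)

/-- A finite, simple, undirected graph whose vertices are labelled by atoms. -/
structure LGraph where
  V : Type
  [fintype : Fintype V]
  adj : V → V → Prop
  symm : ∀ {v w : V}, adj v w → adj w v
  irrefl : ∀ v : V, ¬ adj v v
  label : V → Atom

attribute [instance] LGraph.fintype

namespace LGraph

/-- An isomorphism of labelled graphs: a vertex bijection preserving labels and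
preserving and reflecting edges. -/
structure Iso (G H : LGraph) where
  toEquiv : G.V ≃ H.V
  adj_iff : ∀ v w : G.V, G.adj v w ↔ H.adj (toEquiv v) (toEquiv w)
  label_eq : ∀ v : G.V, H.label (toEquiv v) = G.label v

/-- `G ≅ H` : the graphs `G` and `H` are isomorphic. -/
def iso (G H : LGraph) : Prop := Nonempty (Iso G H)

/-- The empty graph. -/
def empty : LGraph where
  V := Empty
  adj _ _ := False
  symm h := h.elim
  irrefl v := v.elim
  label v := v.elim

/-- The single-vertex graph labelled by the atom `a`. -/
def single (a : Atom) : LGraph where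
  V := Unit
  adj _ _ := False
  symm h := h.elim
  irrefl _ h := h
  label _ := a

def parAdj (G H : LGraph) : G.V ⊕ H.V → G.V ⊕ H.V → Prop
  | .inl a, .inl b => G.adj a b
  | .inr a, .inr b => H.adj a b
  | _, _ => False

/-- The par `G ⅋ H` : disjoint union of `G` and `H`. -/
def par (G H : LGraph) : LGraph where
  V := G.V ⊕ H.V
  adj := parAdj G H
  symm := by
    rintro (a | a) (b | b) h
    · exact G.symm h
    · exact h.elim
    · exact h.elim
    · exact H.symm h
  irrefl := by
    rintro (a | a) h
    · exact G.irrefl a h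
    · exact H.irrefl a h
  label := Sum.elim G.label H.label

def tensorAdj (G H : LGraph) : G.V ⊕ H.V → G.V ⊕ H.V → Prop
  | .inl a, .inl b => G.adj a b
  | .inr a, .inr b => H.adj a b
  | .inl _, .inr _ => True
  | .inr _, .inl _ => True

/-- The tensor `G ⊗ H` : join of `G` and `H` (disjoint union plus all edges in between). -/
def tensor (G H : LGraph) : LGraph where
  V := G.V ⊕ H.V
  adj := tensorAdj G H
  symm := by
    rintro (a | a) (b | b) h
    · exact G.symm h
    · exact trivial
    · exact trivial
    · exact H.symm h
  irrefl := by
    rintro (a | a) h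
    · exact G.irrefl a h
    · exact H.irrefl a h
  label := Sum.elim G.label H.label

/-- The dual graph `Ḡ` : same vertices, complemented edges, dualized labels. -/
def dual (G : LGraph) : LGraph where
  V := G.V
  adj v w := v ≠ w ∧ ¬ G.adj v w
  symm h := ⟨fun e => h.1 e.symm, fun h' => h.2 (G.symm h')⟩
  irrefl _ h := h.1 rfl
  label v := dualAtom (G.label v)

def plugAdj (C : LGraph) (R : Set C.V) (X : LGraph) : C.V ⊕ X.V → C.V ⊕ X.V → Prop
  | .inl a, .inl b => C.adj a b
  | .inr a, .inr b => X.adj a b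
  | .inl a, .inr _ => a ∈ R
  | .inr _, .inl b => b ∈ R

/-- `C[X]_R` : the graph obtained from the context `C[·]_R` by inserting the graph `X`
as a module whose vertices are adjacent exactly to the vertices in `R`. -/
def plug (C : LGraph) (R : Set C.V) (X : LGraph) : LGraph where
  V := C.V ⊕ X.V
  adj := plugAdj C R X
  symm := by
    rintro (a | a) (b | b) h
    · exact C.symm h
    · exact h
    · exact h
    · exact X.symm h
  irrefl := by
    rintro (a | a) h
    · exact C.irrefl a h
    · exact X.irrefl a h
  label := Sum.elim C.label X.label

def compAdj (G : LGraph) (H : G.V → LGraph) :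
    (Σ v : G.V, (H v).V) → (Σ v : G.V, (H v).V) → Prop := fun x y =>
  (∃ (v : G.V) (a b : (H v).V), x = ⟨v, a⟩ ∧ y = ⟨v, b⟩ ∧ (H v).adj a b) ∨
    (x.1 ≠ y.1 ∧ G.adj x.1 y.1)

/-- The composition `G⟨H v₁, …, H vₙ⟩` of the family `H` via the graph `G`:
replace each vertex `v` of `G` by the graph `H v`. -/
def comp (G : LGraph) (H : G.V → LGraph) : LGraph where
  V := Σ v : G.V, (H v).V
  adj := compAdj G H
  symm := by
    rintro x y (⟨v, a, b, hx, hy, hab⟩ | ⟨hne, hadj⟩)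
    · exact Or.inl ⟨v, b, a, hy, hx, (H v).symm hab⟩
    · exact Or.inr ⟨hne.symm, G.symm hadj⟩
  irrefl := by
    rintro ⟨v, a⟩ (⟨w, x, y, hx, hy, hxy⟩ | ⟨hne, _⟩)
    · have h := hx.symm.trans hy
      obtain rfl : x = y := by simpa using h
      exact (H w).irrefl x hxy
    · exact hne rfl
  label x := (H x.1).label x.2

/-- A module of `G` : a set `M` of vertices such that every vertex outside `M`
is adjacent either to all vertices of `M` or to none of them. -/
def IsModule (G : LGraph) (M : Set G.V) : Prop :=
  ∀ v ∉ M, ∀ x ∈ M, ∀ y ∈ M, (G.adj v x ↔ G.adj v y)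

/-- A prime graph: at least 2 vertices and only trivial modules. -/
def Prime (G : LGraph) : Prop :=
  2 ≤ Fintype.card G.V ∧
    ∀ M : Set G.V, G.IsModule M → M = ∅ ∨ (∃ v, M = {v}) ∨ M = Set.univ

/-- `G` is `P₄`-free: no four distinct vertices induce a path on 4 vertices. -/
def P4Free (G : LGraph) : Prop :=
  ¬ ∃ v₁ v₂ v₃ v₄ : G.V,
      v₁ ≠ v₂ ∧ v₁ ≠ v₃ ∧ v₁ ≠ v₄ ∧ v₂ ≠ v₃ ∧ v₂ ≠ v₄ ∧ v₃ ≠ v₄ ∧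
      G.adj v₁ v₂ ∧ G.adj v₂ v₃ ∧ G.adj v₃ v₄ ∧
      ¬ G.adj v₁ v₃ ∧ ¬ G.adj v₁ v₄ ∧ ¬ G.adj v₂ v₄

end LGraph

open LGraph

/-- The `n`-fold tensor `X₁ ⊗ ⋯ ⊗ Xₙ`. -/
def bigTensor : (n : ℕ) → (Fin n → LGraph) → LGraph
  | 0, _ => LGraph.empty
  | n + 1, F => (F 0).tensor (bigTensor n fun i => F i.succ)

/-- The `n`-fold par `X₁ ⅋ ⋯ ⅋ Xₙ`. -/
def bigPar : (n : ℕ) → (Fin n → LGraph) → LGraph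
  | 0, _ => LGraph.empty
  | n + 1, F => (F 0).par (bigPar n fun i => F i.succ)

/-- The inference rules of system GS (premise, conclusion). -/
inductive GSRule : LGraph → LGraph → Prop
  /-- ai↓ : premise `∅`, conclusion `ā ⅋ a`. -/
  | ai (a : Atom) : GSRule LGraph.empty ((single (dualAtom a)).par (single a))
  /-- ss↓ : premise `B[A]_S`, conclusion `B ⅋ A`, for `A ≠ ∅` and `S ≠ ∅`. -/
  | ss (A B : LGraph) (S : Set B.V) :
      Nonempty A.V → S ≠ ∅ → GSRule (B.plug S A) (B.par A)
  /-- p↓ : premise `(M₁ ⅋ N₁) ⊗ ⋯ ⊗ (Mₙ ⅋ Nₙ)`, conclusion `P̄⟨M₁,…,Mₙ⟩ ⅋ P⟨N₁,…,Nₙ⟩`,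
  for `P` prime with `n = |V(P)| ≥ 4` and all `Mᵢ ≠ ∅`. -/
  | p (n : ℕ) (P : LGraph) (e : P.V ≃ Fin n) (M N : Fin n → LGraph) :
      P.Prime → 4 ≤ n → (∀ i, Nonempty (M i).V) →
      GSRule (bigTensor n fun i => (M i).par (N i))
        ((P.dual.comp fun v => M (e v)).par (P.comp fun v => N (e v)))

/-- The "up" rules ai↑, ss↑, p↑ (premise, conclusion). -/
inductive UpRule : LGraph → LGraph → Prop
  /-- ai↑ : premise `a ⊗ ā`, conclusion `∅`. -/
  | ai (a : Atom) : UpRule ((single a).tensor (single (dualAtom a))) LGraph.empty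
  /-- ss↑ : premise `B ⊗ A`, conclusion `B[A]_S`, for `A ≠ ∅` and `S ≠ V(B)`. -/
  | ss (A B : LGraph) (S : Set B.V) :
      Nonempty A.V → S ≠ Set.univ → UpRule (B.tensor A) (B.plug S A)
  /-- p↑ : premise `P⟨M₁,…,Mₙ⟩ ⊗ P̄⟨N₁,…,Nₙ⟩`, conclusion `(M₁ ⊗ N₁) ⅋ ⋯ ⅋ (Mₙ ⊗ Nₙ)`,
  for `P` prime with `n = |V(P)| ≥ 4` and all `Mᵢ ≠ ∅`. -/
  | p (n : ℕ) (P : LGraph) (e : P.V ≃ Fin n) (M N : Fin n → LGraph) :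
      P.Prime → 4 ≤ n → (∀ i, Nonempty (M i).V) →
      UpRule ((P.comp fun v => M (e v)).tensor (P.dual.comp fun v => N (e v)))
        (bigPar n fun i => (M i).tensor (N i))

/-- The rules of system SGS : the rules of GS together with their duals. -/
def SGSRule (G H : LGraph) : Prop := GSRule G H ∨ UpRule G H

/-- A single inference step in a system: inside some context, replace a module
isomorphic to the premise of a rule by the corresponding conclusion. -/
def Step (Rules : LGraph → LGraph → Prop) (G H : LGraph) : Prop :=
  ∃ (C : LGraph) (R : Set C.V) (p c : LGraph),
    Rules p c ∧ G.iso (C.plug R p) ∧ H.iso (C.plug R c)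

/-- A derivation in a system from `G` to `H` : a finite sequence of inference steps
and isomorphisms leading from `G` to `H`. -/
def Deriv (Rules : LGraph → LGraph → Prop) (G H : LGraph) : Prop :=
  Relation.ReflTransGen (fun X Y => X.iso Y ∨ Step Rules X Y) G H

/-- A graph is provable in a system if there is a derivation from `∅` to it. -/
def Provable (Rules : LGraph → LGraph → Prop) (G : LGraph) : Prop :=
  Deriv Rules LGraph.empty G

/-- Formulas: unit, positive and negative atoms, par and tensor. -/
inductive Formula where
  | unit : Formula
  | pos (a : ℕ) : Formula
  | neg (a : ℕ) : Formula
  | par (φ ψ : Formula) : Formula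
  | tens (φ ψ : Formula) : Formula

/-- The graph `[φ]` of a formula `φ`. -/
def Formula.graph : Formula → LGraph
  | .unit => LGraph.empty
  | .pos a => single (a, true)
  | .neg a => single (a, false)
  | .par φ ψ => φ.graph.par ψ.graph
  | .tens φ ψ => φ.graph.tensor ψ.graph

/-- Structural equivalence of formulas: the smallest congruence making `⅋` and `⊗`
associative and commutative with unit `∘`. -/
inductive Formula.equiv : Formula → Formula → Prop
  | refl (φ) : Formula.equiv φ φ
  | symm {φ ψ} : Formula.equiv φ ψ → Formula.equiv ψ φ
  | trans {φ ψ χ} : Formula.equiv φ ψ → Formula.equiv ψ χ → Formula.equiv φ χ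
  | parComm (φ ψ) : Formula.equiv (.par φ ψ) (.par ψ φ)
  | parAssoc (φ ψ χ) : Formula.equiv (.par φ (.par ψ χ)) (.par (.par φ ψ) χ)
  | parUnit (φ) : Formula.equiv (.par φ .unit) φ
  | tensComm (φ ψ) : Formula.equiv (.tens φ ψ) (.tens ψ φ)
  | tensAssoc (φ ψ χ) : Formula.equiv (.tens φ (.tens ψ χ)) (.tens (.tens φ ψ) χ)
  | tensUnit (φ) : Formula.equiv (.tens φ .unit) φ
  | parCongr {φ φ' ψ ψ'} : Formula.equiv φ φ' → Formula.equiv ψ ψ' →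
      Formula.equiv (.par φ ψ) (.par φ' ψ')
  | tensCongr {φ φ' ψ ψ'} : Formula.equiv φ φ' → Formula.equiv ψ ψ' →
      Formula.equiv (.tens φ ψ) (.tens φ' ψ')

/-- A formula is unit-free if it contains no occurrence of the unit `∘`. -/
def Formula.UnitFree : Formula → Prop
  | .unit => False
  | .pos _ => True
  | .neg _ => True
  | .par φ ψ => φ.UnitFree ∧ ψ.UnitFree
  | .tens φ ψ => φ.UnitFree ∧ ψ.UnitFree

/-- The sequent calculus MLL° (multiplicative linear logic with mix) on multisets
of formulas. -/
inductive MLL : Multiset Formula → Prop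
  | ax (a : ℕ) : MLL {Formula.pos a, Formula.neg a}
  | tens {Γ Δ : Multiset Formula} (φ ψ : Formula) :
      MLL (φ ::ₘ Γ) → MLL (ψ ::ₘ Δ) → MLL (Formula.tens φ ψ ::ₘ (Γ + Δ))
  | par {Γ : Multiset Formula} (φ ψ : Formula) :
      MLL (φ ::ₘ ψ ::ₘ Γ) → MLL (Formula.par φ ψ ::ₘ Γ)
  | mix {Γ Δ : Multiset Formula} : MLL Γ → MLL Δ → MLL (Γ + Δ)

section part1
open LGraph

namespace LGraph

theorem iso_mk {G H : LGraph} (f : G.V → H.V) (hi : Function.Injective f)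
    (hs : Function.Surjective f) (ha : ∀ v w, G.adj v w ↔ H.adj (f v) (f w))
    (hl : ∀ v, H.label (f v) = G.label v) : G.iso H :=
  ⟨⟨Equiv.ofBijective f ⟨hi, hs⟩, ha, hl⟩⟩

theorem iso_refl (G : LGraph) : G.iso G := ⟨⟨Equiv.refl _, fun _ _ => Iff.rfl, fun _ => rfl⟩⟩

theorem iso_symm {G H : LGraph} (h : G.iso H) : H.iso G := by
  obtain ⟨e, ha, hl⟩ := h
  refine ⟨⟨e.symm, fun v w => ?_, fun v => ?_⟩⟩
  · rw [ha]; simp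
  · rw [← hl]; simp

theorem iso_trans {G H K : LGraph} (h : G.iso H) (h' : H.iso K) : G.iso K := by
  obtain ⟨e, ha, hl⟩ := h
  obtain ⟨e', ha', hl'⟩ := h'
  refine ⟨⟨e.trans e', fun v w => ?_, fun v => ?_⟩⟩
  · rw [ha, ha']; rfl
  · simp [hl', hl]

theorem plug_congr (C : LGraph) (R : Set C.V) {X Y : LGraph} (h : X.iso Y) :
    (C.plug R X).iso (C.plug R Y) := by
  obtain ⟨e, ha, hl⟩ := h
  refine ⟨⟨Equiv.sumCongr (Equiv.refl _) e, ?_, ?_⟩⟩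
  · rintro (a | a) (b | b) <;> first | exact Iff.rfl | exact ha _ _
  · rintro (a | a) <;> first | rfl | exact hl _

theorem plug_congr_left {C C' : LGraph} (e : Iso C C') (R : Set C.V) (X : LGraph) :
    (C.plug R X).iso (C'.plug (e.toEquiv.symm ⁻¹' R) X) := by
  obtain ⟨e, ha, hl⟩ := e
  refine ⟨⟨Equiv.sumCongr e (Equiv.refl _), ?_, ?_⟩⟩
  · have key : ∀ a : C.V, a ∈ R ↔ e.symm (e a) ∈ R := fun a => by rw [e.symm_apply_apply]
    rintro (a | a) (b | b)
    · exact ha _ _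
    · exact key a
    · exact key b
    · exact Iff.rfl
  · rintro (a | a) <;> first | rfl | exact hl _

theorem par_eq_plug (C X : LGraph) : C.par X = C.plug ∅ X := by
  unfold par plug
  congr 1
  funext x y
  rcases x with a | a <;> rcases y with b | b <;> simp [parAdj, plugAdj]

theorem tensor_eq_plug (C X : LGraph) : C.tensor X = C.plug Set.univ X := by
  unfold tensor plug
  congr 1

theorem par_congr {A B X Y : LGraph} (h : A.iso B) (h' : X.iso Y) :
    (A.par X).iso (B.par Y) := by
  obtain ⟨e, ha, hl⟩ := h
  obtain ⟨e', ha', hl'⟩ := h'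
  refine ⟨⟨Equiv.sumCongr e e', ?_, ?_⟩⟩
  · rintro (a | a) (b | b) <;> first | exact Iff.rfl | exact ha _ _ | exact ha' _ _
  · rintro (a | a) <;> first | rfl | exact hl _ | exact hl' _

theorem par_comm (A B : LGraph) : (A.par B).iso (B.par A) := by
  refine ⟨⟨Equiv.sumComm _ _, ?_, ?_⟩⟩
  · rintro (a | a) (b | b) <;> exact Iff.rfl
  · rintro (a | a) <;> rfl

theorem tensor_comm (A B : LGraph) : (A.tensor B).iso (B.tensor A) := by
  refine ⟨⟨Equiv.sumComm _ _, ?_, ?_⟩⟩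
  · rintro (a | a) (b | b) <;> exact Iff.rfl
  · rintro (a | a) <;> rfl

theorem par_assoc (A B C : LGraph) : ((A.par B).par C).iso (A.par (B.par C)) := by
  refine ⟨⟨Equiv.sumAssoc _ _ _, ?_, ?_⟩⟩
  · rintro ((a | a) | a) ((b | b) | b) <;> exact Iff.rfl
  · rintro ((a | a) | a) <;> rfl

theorem tensor_assoc (A B C : LGraph) : ((A.tensor B).tensor C).iso (A.tensor (B.tensor C)) := by
  refine ⟨⟨Equiv.sumAssoc _ _ _, ?_, ?_⟩⟩
  · rintro ((a | a) | a) ((b | b) | b) <;> exact Iff.rfl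
  · rintro ((a | a) | a) <;> rfl

theorem plug_isEmpty (C : LGraph) (R : Set C.V) (X : LGraph) (h : IsEmpty X.V) :
    C.iso (C.plug R X) :=
  iso_mk (H := C.plug R X) Sum.inl Sum.inl_injective
    (by rintro (a | a); exacts [⟨a, rfl⟩, h.elim a]) (fun _ _ => Iff.rfl) (fun _ => rfl)

theorem isEmpty_plug (C : LGraph) (R : Set C.V) (X : LGraph) (h : IsEmpty C.V) :
    X.iso (C.plug R X) :=
  iso_mk (H := C.plug R X) Sum.inr Sum.inr_injective
    (by rintro (a | a); exacts [h.elim a, ⟨a, rfl⟩]) (fun _ _ => Iff.rfl) (fun _ => rfl)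

instance : IsEmpty LGraph.empty.V := inferInstanceAs (IsEmpty Empty)

theorem iso_empty (X : LGraph) (h : IsEmpty X.V) : X.iso LGraph.empty :=
  iso_mk h.elim (fun a => h.elim a) (fun a => Empty.elim a) (fun a => h.elim a) (fun a => h.elim a)

/-- Composition of contexts. -/
theorem plug_plug (C : LGraph) (R : Set C.V) (D : LGraph) (S : Set D.V) (X : LGraph) :
    (C.plug R (D.plug S X)).iso
      ((C.plug R D).plug {x : (C.plug R D).V | Sum.elim (· ∈ R) (· ∈ S) x} X) := by
  refine ⟨⟨(Equiv.sumAssoc _ _ _).symm, ?_, ?_⟩⟩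
  · rintro (a | a | a) (b | b | b) <;> exact Iff.rfl
  · rintro (a | a | a) <;> rfl

/-- Moving a par-component out of the hole. -/
theorem plug_par (C : LGraph) (R : Set C.V) (X Y : LGraph) :
    (C.plug R (X.par Y)).iso
      ((C.plug R X).plug {x : (C.plug R X).V | Sum.elim (· ∈ R) (fun _ => False) x} Y) := by
  refine ⟨⟨(Equiv.sumAssoc _ _ _).symm, ?_, ?_⟩⟩
  · rintro (a | a | a) (b | b | b) <;> exact Iff.rfl
  · rintro (a | a | a) <;> rfl

theorem plug_tensor (C : LGraph) (R : Set C.V) (X Y : LGraph) :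
    (C.plug R (X.tensor Y)).iso
      ((C.plug R X).plug {x : (C.plug R X).V | Sum.elim (· ∈ R) (fun _ => True) x} Y) := by
  refine ⟨⟨(Equiv.sumAssoc _ _ _).symm, ?_, ?_⟩⟩
  · rintro (a | a | a) (b | b | b) <;> exact Iff.rfl
  · rintro (a | a | a) <;> rfl

/-- A disjoint component added to a context. -/
theorem plug_par_left (C : LGraph) (R : Set C.V) (X Y : LGraph) :
    ((C.plug R X).par Y).iso
      ((C.par Y).plug {x : (C.par Y).V | Sum.elim (· ∈ R) (fun _ => False) x} X) := by
  refine iso_mk (H := (C.par Y).plug {x : (C.par Y).V | Sum.elim (· ∈ R) (fun _ => False) x} X)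
    (fun x : (C.V ⊕ X.V) ⊕ Y.V => match x with
      | .inl (.inl a) => .inl (.inl a)
      | .inl (.inr a) => .inr a
      | .inr a => .inl (.inr a)) ?_ ?_ ?_ ?_
  · rintro ((a | a) | a) ((b | b) | b) h <;> cases h <;> rfl
  · rintro ((a | a) | a)
    exacts [⟨.inl (.inl a), rfl⟩, ⟨.inr a, rfl⟩, ⟨.inl (.inr a), rfl⟩]
  · rintro ((a | a) | a) ((b | b) | b) <;> exact Iff.rfl
  · rintro ((a | a) | a) <;> rfl

@[simp] theorem dual_dual (G : LGraph) : G.dual.dual = G := by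
  rcases G with ⟨V, adj, symm, irr, lab⟩
  simp only [dual]
  congr 1
  · funext v w
    apply propext
    constructor
    · rintro ⟨h1, h2⟩
      by_contra h
      exact h2 ⟨h1, h⟩
    · intro h
      refine ⟨?_, fun h' => h'.2 h⟩
      rintro rfl
      exact irr _ h
  · funext v
    simp [dualAtom]

theorem par_dual (A B : LGraph) : (A.par B).dual = A.dual.tensor B.dual := by
  unfold par dual tensor
  congr 1
  · funext x y
    rcases x with a | a <;> rcases y with b | b <;> simp [tensorAdj, parAdj]
  · funext x
    rcases x with a | a <;> rfl

theorem tensor_dual (A B : LGraph) : (A.tensor B).dual = A.dual.par B.dual := by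
  have := par_dual A.dual B.dual
  rw [dual_dual, dual_dual] at this
  rw [← this, dual_dual]

theorem plug_dual (C : LGraph) (R : Set C.V) (X : LGraph) :
    (C.plug R X).dual = C.dual.plug (Rᶜ : Set C.V) X.dual := by
  unfold plug dual
  congr 1
  · funext x y
    rcases x with a | a <;> rcases y with b | b <;> simp [plugAdj]
  · funext x
    rcases x with a | a <;> rfl

theorem single_dual (a : Atom) : (single a).dual = single (dualAtom a) := by
  unfold single dual
  congr 1
  funext x y
  simp

/-- Induced subgraph. -/
@[reducible] noncomputable def induce (G : LGraph) (J : Set G.V) : LGraph where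
  V := {q : G.V // q ∈ J}
  fintype := Fintype.ofFinite _
  adj a b := G.adj a.1 b.1
  symm h := G.symm h
  irrefl a h := G.irrefl a.1 h
  label a := G.label a.1

theorem comp_adj_same (G : LGraph) (H : G.V → LGraph) (v : G.V) (a b : (H v).V) :
    (G.comp H).adj ⟨v, a⟩ ⟨v, b⟩ ↔ (H v).adj a b := by
  constructor
  · rintro (⟨w, x, y, hx, hy, hxy⟩ | ⟨hne, _⟩)
    · obtain rfl : v = w := congrArg Sigma.fst hx
      obtain rfl : a = x := eq_of_heq (Sigma.mk.inj hx).2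
      obtain rfl : b = y := eq_of_heq (Sigma.mk.inj hy).2
      exact hxy
    · exact (hne rfl).elim
  · intro h
    exact Or.inl ⟨v, a, b, rfl, rfl, h⟩

theorem comp_adj_ne (G : LGraph) (H : G.V → LGraph) (x y : (G.comp H).V) (h : x.1 ≠ y.1) :
    (G.comp H).adj x y ↔ G.adj x.1 y.1 := by
  constructor
  · rintro (⟨w, a, b, rfl, rfl, _⟩ | ⟨_, h'⟩)
    · exact (h rfl).elim
    · exact h'
  · intro h'
    exact Or.inr ⟨h, h'⟩

theorem comp_adj_ne' (G : LGraph) (H : G.V → LGraph) (v w : G.V) (a : (H v).V) (b : (H w).V)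
    (h : v ≠ w) : (G.comp H).adj ⟨v, a⟩ ⟨w, b⟩ ↔ G.adj v w :=
  comp_adj_ne G H ⟨v, a⟩ ⟨w, b⟩ h

theorem comp_dual (G : LGraph) (H : G.V → LGraph) :
    (G.comp H).dual = G.dual.comp (fun v => (H v).dual) := by
  have key : ∀ x y : (G.comp H).V, (G.comp H).dual.adj x y ↔
      (G.dual.comp (fun v => (H v).dual)).adj x y := by
    rintro ⟨v, a⟩ ⟨w, b⟩
    by_cases h : v = w
    · subst h
      refine Iff.trans ?_ (comp_adj_same G.dual (fun v => (H v).dual) v a b).symm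
      change (_ ≠ _ ∧ ¬ (G.comp H).adj _ _) ↔ (a ≠ b ∧ ¬ (H v).adj a b)
      refine and_congr ?_ (not_congr (comp_adj_same G H v a b))
      exact not_congr ⟨fun h => eq_of_heq (Sigma.mk.inj h).2, fun h => by rw [h]⟩
    · refine Iff.trans ?_ (comp_adj_ne' G.dual (fun v => (H v).dual) v w a b h).symm
      change (_ ≠ _ ∧ ¬ (G.comp H).adj _ _) ↔ (v ≠ w ∧ ¬ G.adj v w)
      refine and_congr ?_ (not_congr (comp_adj_ne' G H v w a b h))
      exact ⟨fun _ => h, fun _ e => h (congrArg Sigma.fst e)⟩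
  unfold dual at key ⊢
  unfold comp at key ⊢
  simp only at key ⊢
  congr 1
  funext x y
  exact propext (key x y)

/-- Composition over an induced subgraph. -/
@[reducible] noncomputable def compOn (Q : LGraph) (J : Set Q.V) (κ : Q.V → LGraph) : LGraph :=
  (Q.induce J).comp (fun q => κ q.1)

theorem compOn_adj_ne (Q : LGraph) (J : Set Q.V) (κ : Q.V → LGraph) (q q' : Q.V) (hq : q ∈ J)
    (hq' : q' ∈ J) (a : (κ q).V) (b : (κ q').V) (h : q ≠ q') :
    (compOn Q J κ).adj ⟨⟨q, hq⟩, a⟩ ⟨⟨q', hq'⟩, b⟩ ↔ Q.adj q q' :=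
  comp_adj_ne (Q.induce J) (fun q => κ q.1) ⟨⟨q, hq⟩, a⟩ ⟨⟨q', hq'⟩, b⟩
    (fun h' => h (congrArg Subtype.val h'))

theorem comp_iso_plug (P : LGraph) (p : P.V) (κ : P.V → LGraph) :
    (P.comp κ).iso ((compOn P {p}ᶜ κ).plug {x | P.adj x.1.1 p} (κ p)) := by
  apply iso_symm
  refine iso_mk (G := (compOn P {p}ᶜ κ).plug {x | P.adj x.1.1 p} (κ p))
    (fun x : (compOn P {p}ᶜ κ).V ⊕ (κ p).V =>
    (match x with
    | .inl a => ⟨a.1.1, a.2⟩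
    | .inr a => ⟨p, a⟩ : (P.comp κ).V)) ?_ ?_ ?_ ?_
  · rintro (⟨⟨q, hq⟩, a⟩ | a) (⟨⟨q', hq'⟩, b⟩ | b) h
    · obtain rfl : q = q' := congrArg Sigma.fst h
      obtain rfl : a = b := eq_of_heq (Sigma.mk.inj h).2
      rfl
    · exact (hq (congrArg Sigma.fst h)).elim
    · exact (hq' (congrArg Sigma.fst h).symm).elim
    · obtain rfl : a = b := eq_of_heq (Sigma.mk.inj h).2
      rfl
  · rintro ⟨q, a⟩
    by_cases h : q = p
    · subst h
      exact ⟨.inr a, rfl⟩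
    · exact ⟨.inl ⟨⟨q, h⟩, a⟩, rfl⟩
  · rintro (⟨⟨q, hq⟩, a⟩ | a) (⟨⟨q', hq'⟩, b⟩ | b)
    · by_cases h : q = q'
      · subst h
        exact (comp_adj_same (P.induce {p}ᶜ) (fun q => κ q.1) ⟨q, hq⟩ a b).trans
          (comp_adj_same P κ q a b).symm
      · exact (comp_adj_ne' (P.induce {p}ᶜ) (fun q => κ q.1) ⟨q, hq⟩ ⟨q', hq'⟩ a b
          (fun h' => h (congrArg Subtype.val h'))).trans (comp_adj_ne' P κ q q' a b h).symm
    · exact (comp_adj_ne' P κ q p a b hq).symm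
    · refine Iff.trans ?_ (comp_adj_ne' P κ p q' a b (fun h => hq' h.symm)).symm
      exact ⟨fun h => P.symm h, fun h => P.symm h⟩
    · exact (comp_adj_same P κ p a b).symm
  · rintro (⟨⟨q, hq⟩, a⟩ | a) <;> rfl

theorem comp_iso_plug' (P : LGraph) (p : P.V) (κ κ' : P.V → LGraph)
    (h : ∀ q, q ≠ p → κ' q = κ q) :
    (P.comp κ').iso ((compOn P {p}ᶜ κ).plug {x | P.adj x.1.1 p} (κ' p)) := by
  have := comp_iso_plug P p κ'
  unfold compOn at this ⊢
  have e : (fun q : (P.induce {p}ᶜ).V => κ' q.1) = (fun q => κ q.1) := by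
    funext q
    exact h q.1 q.2
  rw [e] at this
  exact this

theorem comp_equiv (P P' : LGraph) (e : P.V ≃ P'.V) (he : ∀ v w, P.adj v w ↔ P'.adj (e v) (e w))
    (κ : P'.V → LGraph) : (P.comp (fun p => κ (e p))).iso (P'.comp κ) := by
  refine iso_mk (fun x : (P.comp (fun p => κ (e p))).V => (⟨e x.1, x.2⟩ : (P'.comp κ).V))
    ?_ ?_ ?_ ?_
  · rintro ⟨v, a⟩ ⟨w, b⟩ h
    obtain rfl : v = w := e.injective (congrArg Sigma.fst h)
    obtain rfl : a = b := eq_of_heq (Sigma.mk.inj h).2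
    rfl
  · rintro ⟨v, a⟩
    obtain ⟨v, rfl⟩ := e.surjective v
    exact ⟨⟨v, a⟩, rfl⟩
  · rintro ⟨v, a⟩ ⟨w, b⟩
    by_cases h : v = w
    · subst h
      exact (comp_adj_same P (fun p => κ (e p)) v a b).trans (comp_adj_same P' κ (e v) a b).symm
    · exact (comp_adj_ne' P (fun p => κ (e p)) v w a b h).trans ((he v w).trans
        (comp_adj_ne' P' κ (e v) (e w) a b (fun h' => h (e.injective h'))).symm)
  · intro x; rfl

theorem compOn_empty (Q : LGraph) (J : Set Q.V) (hJ : J = ∅) (κ : Q.V → LGraph) :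
    (compOn Q J κ).iso LGraph.empty := by
  apply iso_empty
  subst hJ
  exact ⟨fun x => x.1.2⟩

theorem compOn_single (Q : LGraph) (q : Q.V) (κ : Q.V → LGraph) :
    (κ q).iso (compOn Q {q} κ) := by
  refine iso_mk (fun a => (⟨⟨q, rfl⟩, a⟩ : (compOn Q {q} κ).V)) ?_ ?_ ?_ ?_
  · intro a b h
    exact eq_of_heq (Sigma.mk.inj h).2
  · rintro ⟨⟨q', rfl⟩, a⟩
    exact ⟨a, rfl⟩
  · intro a b
    exact (comp_adj_same (Q.induce {q}) (fun q => κ q.1) ⟨q, rfl⟩ a b).symm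
  · intro a; rfl

theorem compOn_plug (Q : LGraph) (J J1 J2 : Set Q.V) (h : J1 ∪ J2 = J) (hd : Disjoint J1 J2)
    (κ : Q.V → LGraph) (b : Prop) (hb : ∀ x ∈ J1, ∀ y ∈ J2, (Q.adj x y ↔ b)) :
    ((compOn Q J1 κ).plug {_x | b} (compOn Q J2 κ)).iso (compOn Q J κ) := by
  have h1 : ∀ x ∈ J1, x ∈ J := fun x hx => h ▸ Or.inl hx
  have h2 : ∀ x ∈ J2, x ∈ J := fun x hx => h ▸ Or.inr hx
  have h3 : ∀ x ∈ J1, x ∉ J2 := fun x hx hx' => Set.disjoint_left.mp hd hx hx'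
  refine iso_mk (G := (compOn Q J1 κ).plug {_x | b} (compOn Q J2 κ))
    (fun x : (compOn Q J1 κ).V ⊕ (compOn Q J2 κ).V => (match x with
    | .inl a => ⟨⟨a.1.1, h1 _ a.1.2⟩, a.2⟩
    | .inr a => ⟨⟨a.1.1, h2 _ a.1.2⟩, a.2⟩ : (compOn Q J κ).V)) ?_ ?_ ?_ ?_
  · rintro (⟨⟨q, hq⟩, a⟩ | ⟨⟨q, hq⟩, a⟩) (⟨⟨q', hq'⟩, b⟩ | ⟨⟨q', hq'⟩, b⟩) h
    · obtain rfl : q = q' := congrArg (fun z => z.1.1) h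
      obtain rfl : a = b := eq_of_heq (Sigma.mk.inj h).2
      rfl
    · obtain rfl : q = q' := congrArg (fun z => z.1.1) h
      exact (h3 _ hq hq').elim
    · obtain rfl : q = q' := congrArg (fun z => z.1.1) h
      exact (h3 _ hq' hq).elim
    · obtain rfl : q = q' := congrArg (fun z => z.1.1) h
      obtain rfl : a = b := eq_of_heq (Sigma.mk.inj h).2
      rfl
  · rintro ⟨⟨q, hq⟩, a⟩
    have hq' := hq
    rw [← h] at hq'
    rcases hq' with hq' | hq'
    · exact ⟨.inl ⟨⟨q, hq'⟩, a⟩, rfl⟩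
    · exact ⟨.inr ⟨⟨q, hq'⟩, a⟩, rfl⟩
  · have aux : ∀ (J' : Set Q.V) (hJ : ∀ x ∈ J', x ∈ J) (x y : (compOn Q J' κ).V),
        (compOn Q J' κ).adj x y ↔
        (compOn Q J κ).adj ⟨⟨x.1.1, hJ _ x.1.2⟩, x.2⟩ ⟨⟨y.1.1, hJ _ y.1.2⟩, y.2⟩ := by
      rintro J' hJ ⟨⟨q, hq⟩, a⟩ ⟨⟨q', hq'⟩, b⟩
      by_cases h : q = q'
      · subst h
        exact (comp_adj_same (Q.induce J') (fun q => κ q.1) _ _ _).trans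
          (comp_adj_same (Q.induce J) (fun q => κ q.1) ⟨q, hJ _ hq⟩ a b).symm
      · exact (compOn_adj_ne Q J' κ q q' hq hq' a b h).trans
          (compOn_adj_ne Q J κ q q' (hJ _ hq) (hJ _ hq') a b h).symm
    rintro (x | x) (y | y)
    · exact aux J1 h1 x y
    · rcases x with ⟨⟨q, hq⟩, a⟩
      rcases y with ⟨⟨q', hq'⟩, a'⟩
      refine Iff.trans ?_ (comp_adj_ne (Q.induce J) (fun q => κ q.1) _ _ ?_).symm
      · exact (hb q hq q' hq').symm
      · intro h'
        obtain rfl : q = q' := congrArg Subtype.val h'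
        exact h3 _ hq hq'
    · rcases x with ⟨⟨q, hq⟩, a⟩
      rcases y with ⟨⟨q', hq'⟩, a'⟩
      refine Iff.trans ?_ (comp_adj_ne (Q.induce J) (fun q => κ q.1) _ _ ?_).symm
      · refine (hb q' hq' q hq).symm.trans ⟨fun h => Q.symm h, fun h => Q.symm h⟩
      · intro h'
        obtain rfl : q = q' := congrArg Subtype.val h'
        exact h3 _ hq' hq
    · exact aux J2 h2 x y
  · rintro (x | x) <;> rfl

theorem compOn_comp (Q : LGraph) (J : Set Q.V) (κ : Q.V → LGraph) (P : LGraph) (c : Q.V → P.V)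
    (hc : ∀ x ∈ J, ∀ y ∈ J, c x ≠ c y → (Q.adj x y ↔ P.adj (c x) (c y))) :
    (P.comp (fun p => compOn Q (J ∩ c ⁻¹' {p}) κ)).iso (compOn Q J κ) := by
  refine iso_mk (fun x : (P.comp (fun p => compOn Q (J ∩ c ⁻¹' {p}) κ)).V =>
    (⟨⟨x.2.1.1, x.2.1.2.1⟩, x.2.2⟩ : (compOn Q J κ).V)) ?_ ?_ ?_ ?_
  · rintro ⟨p, ⟨⟨q, hq, hqp⟩, a⟩⟩ ⟨p', ⟨⟨q', hq', hqp'⟩, a'⟩⟩ h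
    obtain rfl : q = q' := congrArg (fun z => z.1.1) h
    obtain rfl : a = a' := eq_of_heq (Sigma.mk.inj h).2
    cases hqp
    cases hqp'
    rfl
  · rintro ⟨⟨q, hq⟩, a⟩
    exact ⟨⟨c q, ⟨⟨q, hq, rfl⟩, a⟩⟩, rfl⟩
  · rintro ⟨p, ⟨⟨q, hq, hqp⟩, a⟩⟩ ⟨p', ⟨⟨q', hq', hqp'⟩, a'⟩⟩
    cases hqp
    cases hqp'
    by_cases h : c q = c q'
    · have key : ∀ (p : P.V) (x y : (compOn Q (J ∩ c ⁻¹' {p}) κ).V),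
          (compOn Q (J ∩ c ⁻¹' {p}) κ).adj x y ↔ (compOn Q J κ).adj
            ⟨⟨x.1.1, x.1.2.1⟩, x.2⟩ ⟨⟨y.1.1, y.1.2.1⟩, y.2⟩ := by
        rintro p ⟨⟨q, hq⟩, a⟩ ⟨⟨q', hq'⟩, b⟩
        by_cases h : q = q'
        · subst h
          exact (comp_adj_same (Q.induce _) (fun q => κ q.1) _ _ _).trans
            (comp_adj_same (Q.induce J) (fun q => κ q.1) ⟨q, hq.1⟩ a b).symm
        · exact (compOn_adj_ne Q _ κ q q' hq hq' a b h).trans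
            (compOn_adj_ne Q J κ q q' hq.1 hq'.1 a b h).symm
      have e : (⟨c q', ⟨⟨q', hq', rfl⟩, a'⟩⟩ : (P.comp (fun p => compOn Q (J ∩ c ⁻¹' {p}) κ)).V)
          = ⟨c q, ⟨⟨q', hq', h.symm⟩, a'⟩⟩ := by
        have : ∀ (p : P.V) (hp : c q' = p), (⟨c q', ⟨⟨q', hq', rfl⟩, a'⟩⟩ :
            (P.comp (fun p => compOn Q (J ∩ c ⁻¹' {p}) κ)).V)
          = ⟨p, ⟨⟨q', hq', hp⟩, a'⟩⟩ := by
          rintro _ rfl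
          rfl
        exact this _ h.symm
      have e2 := comp_adj_same P (fun p => compOn Q (J ∩ c ⁻¹' {p}) κ) (c q)
        ⟨⟨q, hq, rfl⟩, a⟩ ⟨⟨q', hq', h.symm⟩, a'⟩
      rw [← e] at e2
      exact e2.trans (key _ _ _)
    · refine (comp_adj_ne' P (fun p => compOn Q (J ∩ c ⁻¹' {p}) κ) (c q) (c q') _ _ h).trans ?_
      refine Iff.trans ?_ (compOn_adj_ne Q J κ q q' hq hq' a a' ?_).symm
      · exact (hc q hq q' hq' h).symm
      · rintro rfl
        exact h rfl
  · intro x; rfl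

theorem comp_single_iso (G : LGraph) :
    (compOn G Set.univ (fun v => single (G.label v))).iso G := by
  refine iso_mk (fun x : (compOn G Set.univ (fun v => single (G.label v))).V => x.1.1) ?_ ?_ ?_ ?_
  · rintro ⟨⟨v, hv⟩, a⟩ ⟨⟨w, hw⟩, b⟩ h
    obtain rfl : v = w := h
    rfl
  · intro v
    exact ⟨⟨⟨v, trivial⟩, ()⟩, rfl⟩
  · rintro ⟨⟨v, hv⟩, a⟩ ⟨⟨w, hw⟩, b⟩
    by_cases h : v = w
    · subst h
      refine (comp_adj_same (G.induce Set.univ) (fun q => single (G.label q.1)) _ _ _).trans ?_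
      exact ⟨fun h => h.elim, fun h => (G.irrefl _ h).elim⟩
    · refine comp_adj_ne (G.induce Set.univ) (fun q => single (G.label q.1)) _ _ ?_
      exact fun h' => h (congrArg Subtype.val h')
  · intro x; rfl

end LGraph
end part1

section part2
open LGraph

abbrev Der (X Y : LGraph) : Prop := Deriv GSRule X Y

theorem Der.refl (X : LGraph) : Der X X := Relation.ReflTransGen.refl

theorem Der.trans {X Y Z : LGraph} (h : Der X Y) (h' : Der Y Z) : Der X Z :=
  Relation.ReflTransGen.trans h h'

theorem Der.ofIso {X Y : LGraph} (h : X.iso Y) : Der X Y :=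
  Relation.ReflTransGen.single (Or.inl h)

theorem Der.ctx (C : LGraph) (R : Set C.V) {X Y : LGraph} (h : Der X Y) :
    Der (C.plug R X) (C.plug R Y) := by
  induction h with
  | refl => exact Der.refl _
  | tail _ h ih =>
    refine ih.trans ?_
    rcases h with h | ⟨D, S, p, c, hr, h1, h2⟩
    · exact Der.ofIso (plug_congr C R h)
    · exact Relation.ReflTransGen.single (Or.inr ⟨C.plug R D, _, p, c, hr,
        iso_trans (plug_congr C R h1) (plug_plug C R D S p),
        iso_trans (plug_congr C R h2) (plug_plug C R D S c)⟩)

theorem Der.ofRule {X Y : LGraph} (h : GSRule X Y) : Der X Y :=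
  Relation.ReflTransGen.single (Or.inr ⟨LGraph.empty, ∅, X, Y, h,
    isEmpty_plug _ _ _ inferInstance, isEmpty_plug _ _ _ inferInstance⟩)

/-- unconditional `ss` -/
theorem Der.ss (B : LGraph) (S : Set B.V) (A : LGraph) : Der (B.plug S A) (B.par A) := by
  by_cases hA : Nonempty A.V
  · by_cases hS : S = ∅
    · subst hS
      rw [par_eq_plug]
      exact Der.refl _
    · exact Der.ofRule (GSRule.ss A B S hA hS)
  · rw [not_nonempty_iff] at hA
    rw [par_eq_plug]
    exact Der.ofIso (iso_trans (iso_symm (plug_isEmpty B S A hA)) (plug_isEmpty B ∅ A hA))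

theorem Der.parRight {X Y : LGraph} (h : Der X Y) (U : LGraph) : Der (U.par X) (U.par Y) := by
  rw [par_eq_plug, par_eq_plug]
  exact Der.ctx _ _ h

theorem Der.parLeft {X Y : LGraph} (h : Der X Y) (U : LGraph) : Der (X.par U) (Y.par U) :=
  ((Der.ofIso (par_comm X U)).trans (h.parRight U)).trans (Der.ofIso (par_comm U Y))

theorem provable_plug {C X : LGraph} (R : Set C.V) (hC : Provable GSRule C)
    (hX : Provable GSRule X) : Provable GSRule (C.plug R X) :=
  (Der.trans hC (Der.ofIso (plug_isEmpty C R LGraph.empty inferInstance))).trans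
    (Der.ctx C R hX)

def Imp (X Y : LGraph) : Prop :=
  ∃ (D : LGraph) (R : Set D.V), Provable GSRule D ∧ Der (D.plug R X) Y

theorem Imp.ofDer {X Y : LGraph} (h : Der X Y) : Imp X Y :=
  ⟨LGraph.empty, ∅, Der.refl _,
    (Der.ofIso (iso_symm (isEmpty_plug _ _ _ inferInstance))).trans h⟩

theorem Imp.trans {X Y Z : LGraph} (h : Imp X Y) (h' : Imp Y Z) : Imp X Z := by
  obtain ⟨D, R, hD, hXY⟩ := h
  obtain ⟨E, S, hE, hYZ⟩ := h'
  exact ⟨E.plug S D, _, provable_plug S hE hD,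
    ((Der.ofIso (iso_symm (plug_plug E S D R X))).trans (Der.ctx E S hXY)).trans hYZ⟩

theorem Imp.parRight {X Y : LGraph} (h : Imp X Y) (U : LGraph) : Imp (X.par U) (Y.par U) := by
  obtain ⟨D, R, hD, hXY⟩ := h
  exact ⟨D, R, hD, ((Der.ofIso (plug_par D R X U)).trans (Der.ss _ _ _)).trans (hXY.parLeft U)⟩

instance isoSetoid : Setoid LGraph := ⟨iso, ⟨iso_refl, iso_symm, iso_trans⟩⟩

/-- isomorphism classes of graphs -/
def KQ : Type 1 := Quotient isoSetoid

def mk (G : LGraph) : KQ := Quotient.mk isoSetoid G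

theorem mk_eq {G H : LGraph} (h : G.iso H) : mk G = mk H := Quotient.sound h

theorem mk_surj (x : KQ) : ∃ G, mk G = x := Quotient.exists_rep x

def KQ.add : KQ → KQ → KQ :=
  Quotient.map₂ (fun a b => a.par b) (fun _ _ h _ _ h' => par_congr h h')

instance : Zero KQ := ⟨mk LGraph.empty⟩
instance : Add KQ := ⟨KQ.add⟩

theorem mk_par (G H : LGraph) : mk (G.par H) = mk G + mk H := rfl

theorem mk_empty : mk LGraph.empty = 0 := rfl

theorem KQ.zero_add' (x : KQ) : 0 + x = x := by
  obtain ⟨G, rfl⟩ := mk_surj x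
  rw [← mk_empty, ← mk_par, par_eq_plug]
  exact (mk_eq (isEmpty_plug _ _ _ inferInstance)).symm

theorem KQ.add_comm' (x y : KQ) : x + y = y + x := by
  obtain ⟨G, rfl⟩ := mk_surj x
  obtain ⟨H, rfl⟩ := mk_surj y
  exact mk_eq (par_comm G H)

instance : AddCommMonoid KQ where
  add_assoc x y z := by
    obtain ⟨G, rfl⟩ := mk_surj x
    obtain ⟨H, rfl⟩ := mk_surj y
    obtain ⟨K, rfl⟩ := mk_surj z
    exact mk_eq (par_assoc G H K)
  zero_add := KQ.zero_add'
  add_zero x := by rw [KQ.add_comm', KQ.zero_add']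
  add_comm := KQ.add_comm'
  nsmul := nsmulRec

def KQ.le (x y : KQ) : Prop := ∃ X Y, mk X = x ∧ mk Y = y ∧ Imp X Y

instance : LE KQ := ⟨KQ.le⟩

theorem mk_le {X Y : LGraph} : mk X ≤ mk Y ↔ Imp X Y := by
  constructor
  · rintro ⟨X', Y', h1, h2, h⟩
    have h1 : X'.iso X := Quotient.exact h1
    have h2 : Y'.iso Y := Quotient.exact h2
    exact ((Imp.ofDer (Der.ofIso (iso_symm h1))).trans h).trans (Imp.ofDer (Der.ofIso h2))
  · intro h
    exact ⟨X, Y, rfl, rfl, h⟩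

theorem mk_le_of_der {X Y : LGraph} (h : Der X Y) : mk X ≤ mk Y := mk_le.mpr (Imp.ofDer h)

instance : Preorder KQ where
  le_refl x := by
    obtain ⟨G, rfl⟩ := mk_surj x
    exact mk_le_of_der (Der.refl G)
  le_trans x y z := by
    obtain ⟨G, rfl⟩ := mk_surj x
    obtain ⟨H, rfl⟩ := mk_surj y
    obtain ⟨K, rfl⟩ := mk_surj z
    rw [mk_le, mk_le, mk_le]
    exact Imp.trans

theorem KQ.add_le_add_right' (x y : KQ) (h : x ≤ y) (u : KQ) : x + u ≤ y + u := by
  obtain ⟨G, rfl⟩ := mk_surj x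
  obtain ⟨H, rfl⟩ := mk_surj y
  obtain ⟨K, rfl⟩ := mk_surj u
  rw [← mk_par, ← mk_par, mk_le]
  exact (mk_le.mp h).parRight K

instance : IsOrderedAddMonoid KQ where
  add_le_add_left x y h u := KQ.add_le_add_right' x y h u

theorem prov_iff {G : LGraph} : 0 ≤ mk G ↔ Provable GSRule G := by
  rw [← mk_empty, mk_le]
  constructor
  · rintro ⟨D, R, hD, h⟩
    exact (Der.trans hD (Der.ofIso (plug_isEmpty D R LGraph.empty inferInstance))).trans h
  · intro h
    exact ⟨G, ∅, h, Der.ofIso (iso_symm (plug_isEmpty _ _ _ inferInstance))⟩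

/-- General context facts. -/
theorem gC1 (C : LGraph) (R : Set C.V) (X U : LGraph) :
    mk (C.plug R (X.par U)) ≤ mk (C.plug R X) + mk U :=
  mk_le_of_der ((Der.ofIso (plug_par C R X U)).trans (Der.ss _ _ _))

theorem gC2 (C : LGraph) (R : Set C.V) (X : LGraph) (u : KQ) (h : 0 ≤ mk X + u) :
    mk C ≤ mk (C.plug R X) + u := by
  obtain ⟨U, rfl⟩ := mk_surj u
  rw [← mk_par, prov_iff] at h
  refine le_trans (mk_le_of_der ?_) (gC1 C R X U)
  exact (Der.ofIso (plug_isEmpty C R LGraph.empty inferInstance)).trans (Der.ctx C R h)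

theorem gC3 (C : LGraph) (R : Set C.V) (X : LGraph) (u : KQ) (h : 0 ≤ mk C + u) :
    mk X ≤ mk (C.plug R X) + u := by
  obtain ⟨U, rfl⟩ := mk_surj u
  rw [← mk_par, prov_iff] at h
  rw [← mk_par, mk_le]
  exact ⟨C.par U, _, h, Der.ofIso (iso_symm (plug_par_left C R X U))⟩

theorem C1 (P : LGraph) (p : P.V) (κ κ' : P.V → LGraph) (h : ∀ q, q ≠ p → κ' q = κ q) (u : KQ)
    (hu : mk (κ' p) = mk (κ p) + u) : mk (P.comp κ') ≤ mk (P.comp κ) + u := by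
  obtain ⟨U, rfl⟩ := mk_surj u
  rw [mk_eq (comp_iso_plug' P p κ κ' h), mk_eq (comp_iso_plug P p κ)]
  refine le_trans (le_of_eq ?_) (gC1 _ _ _ _)
  have hu' : (κ' p).iso ((κ p).par U) := Quotient.exact hu
  exact mk_eq (plug_congr _ _ hu')

theorem C2 (P : LGraph) (p : P.V) (κ : P.V → LGraph) (u : KQ) (hu : 0 ≤ mk (κ p) + u) :
    mk (compOn P {p}ᶜ κ) ≤ mk (P.comp κ) + u := by
  rw [mk_eq (comp_iso_plug P p κ)]
  exact gC2 _ _ _ _ hu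

theorem C3 (P : LGraph) (p : P.V) (κ : P.V → LGraph) (u : KQ)
    (hu : 0 ≤ mk (compOn P {p}ᶜ κ) + u) : mk (κ p) ≤ mk (P.comp κ) + u := by
  rw [mk_eq (comp_iso_plug P p κ)]
  exact gC3 _ _ _ _ hu

theorem provable_bigTensor (n : ℕ) (F : Fin n → LGraph) (h : ∀ i, Provable GSRule (F i)) :
    Provable GSRule (bigTensor n F) := by
  induction n with
  | zero => exact Der.refl _
  | succ n ih =>
    unfold bigTensor
    rw [tensor_eq_plug]
    exact provable_plug _ (h 0) (ih _ fun i => h i.succ)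

theorem imp_bigTensor (n : ℕ) (F : Fin n → LGraph) (i : Fin n)
    (h : ∀ j, j ≠ i → Provable GSRule (F j)) : Imp (F i) (bigTensor n F) := by
  induction n with
  | zero => exact i.elim0
  | succ n ih =>
    unfold bigTensor
    by_cases hi : i = 0
    · subst hi
      refine ⟨bigTensor n fun i => F i.succ, Set.univ,
        provable_bigTensor _ _ fun i => h _ (Fin.succ_ne_zero i), ?_⟩
      rw [← tensor_eq_plug]
      exact Der.ofIso (tensor_comm _ _)
    · obtain ⟨j, rfl⟩ := Fin.exists_succ_eq.mpr hi
      refine (ih (fun i => F i.succ) j fun k hk => h _ fun e => hk (Fin.succ_injective _ e)).trans ?_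
      refine ⟨F 0, Set.univ, h 0 (Ne.symm hi), ?_⟩
      rw [← tensor_eq_plug]
      exact Der.refl _

theorem C4 (P : LGraph) (hP : P.Prime) (hc : 4 ≤ Fintype.card P.V) (k l : P.V → LGraph)
    (hk : ∀ p, Nonempty (k p).V) (p : P.V) (h : ∀ j, j ≠ p → 0 ≤ mk (k j) + mk (l j)) :
    mk (k p) + mk (l p) ≤ mk (P.dual.comp k) + mk (P.comp l) := by
  let e := Fintype.equivFin P.V
  have hr := GSRule.p (Fintype.card P.V) P e (fun i => k (e.symm i)) (fun i => l (e.symm i)) hP hc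
    (fun i => hk _)
  have e1 : (fun v => k (e.symm (e v))) = k := by funext v; rw [e.symm_apply_apply]
  have e2 : (fun v => l (e.symm (e v))) = l := by funext v; rw [e.symm_apply_apply]
  simp only [e2] at hr
  have hr' : GSRule (bigTensor (Fintype.card P.V) fun i => (k (e.symm i)).par (l (e.symm i)))
      ((P.dual.comp k).par (P.comp l)) := by
    have e3 : (P.dual.comp fun v => k (e.symm (e v))) = P.dual.comp k := congrArg _ e1
    rw [← e3]
    exact hr
  have h1 := imp_bigTensor (Fintype.card P.V) (fun i => (k (e.symm i)).par (l (e.symm i))) (e p) (by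
    intro j hj
    rw [← prov_iff, mk_par]
    exact h _ fun e' => hj (by rw [← e', e.apply_symm_apply]))
  have h2 := h1.trans (Imp.ofDer (Der.ofRule hr'))
  simp only [e.symm_apply_apply] at h2
  rw [← mk_par, ← mk_par, mk_le]
  exact h2

theorem C5 (Q : LGraph) (J J1 J2 : Set Q.V) (h : J1 ∪ J2 = J) (hd : Disjoint J1 J2)
    (κ : Q.V → LGraph) (hb : ∀ x ∈ J1, ∀ y ∈ J2, Q.adj x y) (u : KQ)
    (hu : 0 ≤ mk (compOn Q J1 κ) + u) : mk (compOn Q J2 κ) ≤ mk (compOn Q J κ) + u := by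
  rw [← mk_eq (compOn_plug Q J J1 J2 h hd κ True (fun x hx y hy => iff_true_intro (hb x hx y hy)))]
  exact gC3 _ _ _ _ hu

theorem C6 (Q : LGraph) (J J1 J2 : Set Q.V) (h : J1 ∪ J2 = J) (hd : Disjoint J1 J2)
    (κ : Q.V → LGraph) (hb : ∀ x ∈ J1, ∀ y ∈ J2, ¬ Q.adj x y) :
    mk (compOn Q J κ) = mk (compOn Q J1 κ) + mk (compOn Q J2 κ) := by
  rw [← mk_eq (compOn_plug Q J J1 J2 h hd κ False (fun x hx y hy => iff_false_intro (hb x hx y hy)))]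
  rw [← mk_par, par_eq_plug]
  rfl

theorem ai_prov (a : Atom) : 0 ≤ mk (single (dualAtom a)) + mk (single a) := by
  rw [← mk_par, prov_iff]
  exact Der.ofRule (GSRule.ai a)

end part2

section part3
open LGraph

theorem dualAtom_dualAtom (a : Atom) : dualAtom (dualAtom a) = a := by
  simp [dualAtom]

/-- A labelled graph on a fixed vertex type. -/
@[ext] structure LG (V : Type) where
  adj : V → V → Prop
  symm : ∀ {v w : V}, adj v w → adj w v
  irrefl : ∀ v : V, ¬ adj v v
  label : V → Atom

def LG.dual {V : Type} (g : LG V) : LG V where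
  adj v w := v ≠ w ∧ ¬ g.adj v w
  symm h := ⟨fun e => h.1 e.symm, fun h' => h.2 (g.symm h')⟩
  irrefl _ h := h.1 rfl
  label v := dualAtom (g.label v)

@[simp] theorem LG.dual_dual {V : Type} (g : LG V) : g.dual.dual = g := by
  ext v w
  · constructor
    · rintro ⟨h1, h2⟩
      by_contra h
      exact h2 ⟨h1, h⟩
    · intro h
      refine ⟨?_, fun h' => h'.2 h⟩
      rintro rfl
      exact g.irrefl _ h
  · simp [LG.dual, dualAtom]
  · simp [LG.dual, dualAtom]

variable {V : Type} {g : LG V} {S A B : Set V}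

theorem LG.comm {v w : V} : g.adj v w ↔ g.adj w v := ⟨fun h => g.symm h, fun h => g.symm h⟩

/-- `S` is the disjoint union of nonempty `A`, `B` without edges in between. -/
structure Split (g : LG V) (S A B : Set V) : Prop where
  un : A ∪ B = S
  disj : Disjoint A B
  neA : A.Nonempty
  neB : B.Nonempty
  no : ∀ x ∈ A, ∀ y ∈ B, ¬ g.adj x y

theorem Split.swap (h : Split g S A B) : Split g S B A :=
  ⟨by rw [Set.union_comm]; exact h.un, h.disj.symm, h.neB, h.neA,
    fun x hx y hy hxy => h.no y hy x hx (g.symm hxy)⟩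

theorem Split.subA (h : Split g S A B) : A ⊆ S := h.un ▸ Set.subset_union_left
theorem Split.subB (h : Split g S A B) : B ⊆ S := h.un ▸ Set.subset_union_right

theorem Split.ne (h : Split g S A B) {x : V} (hA : x ∈ A) (hB : x ∈ B) : False :=
  Set.disjoint_left.mp h.disj hA hB

theorem Split.full (h : Split g.dual S A B) : ∀ x ∈ A, ∀ y ∈ B, g.adj x y := by
  intro x hx y hy
  by_contra hxy
  refine h.no x hx y hy ⟨?_, hxy⟩
  rintro rfl
  exact h.ne hx hy

theorem Split.mk_dual (un : A ∪ B = S) (disj : Disjoint A B) (neA : A.Nonempty) (neB : B.Nonempty)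
    (h : ∀ x ∈ A, ∀ y ∈ B, g.adj x y) : Split g.dual S A B :=
  ⟨un, disj, neA, neB, fun x hx y hy hxy => hxy.2 (h x hx y hy)⟩

theorem split_excl {A' B' : Set V} (h : Split g S A B) (h' : Split g.dual S A' B') : False := by
  have key : ∀ A' B' : Set V, Split g.dual S A' B' → ∀ a ∈ A, a ∉ A' := by
    intro A' B' h' a ha ha'
    obtain ⟨z, hz⟩ := h'.neB
    obtain ⟨b, hb⟩ := h.neB
    have hB : ∀ z ∈ B', z ∈ A := by
      intro z hz
      have hzS : z ∈ A ∪ B := by rw [h.un]; exact h'.subB hz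
      rcases hzS with hzA | hzB
      · exact hzA
      · exact (h.no a ha z hzB (h'.full a ha' z hz)).elim
    have hbS : b ∈ A' ∪ B' := by rw [h'.un]; exact h.subB hb
    rcases hbS with hb' | hb'
    · exact h.no z (hB z hz) b hb (g.symm (h'.full b hb' z hz))
    · exact h.ne (hB b hb') hb
  obtain ⟨a, ha⟩ := h.neA
  have haS : a ∈ A' ∪ B' := by rw [h'.un]; exact h.subA ha
  rcases haS with ha' | ha'
  · exact key A' B' h' a ha ha'
  · exact key B' A' h'.swap a ha ha'

structure Mod (g : LG V) (S A : Set V) : Prop where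
  sub : A ⊆ S
  unif : ∀ v ∈ S, v ∉ A → ∀ x ∈ A, ∀ y ∈ A, (g.adj v x ↔ g.adj v y)

theorem Mod.dual (h : Mod g S A) : Mod g.dual S A := by
  refine ⟨h.sub, fun v hv hvA x hx y hy => ?_⟩
  have h1 : v ≠ x := fun e => hvA (e ▸ hx)
  have h2 : v ≠ y := fun e => hvA (e ▸ hy)
  simp only [LG.dual, ne_eq, h1, h2, not_false_eq_true, true_and]
  rw [h.unif v hv hvA x hx y hy]

theorem Split.modA (h : Split g S A B) : Mod g S A := by
  refine ⟨h.subA, fun v hv hvA x hx y hy => ?_⟩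
  rw [← h.un] at hv
  have hvB := hv.resolve_left hvA
  exact ⟨fun h' => (h.no x hx v hvB (g.symm h')).elim, fun h' => (h.no y hy v hvB (g.symm h')).elim⟩

theorem Mod.restrict {S' : Set V} (h : Mod g S A) (h' : S' ⊆ S) : Mod g S' (A ∩ S') :=
  ⟨Set.inter_subset_right, fun v hv hvA x hx y hy =>
    h.unif v (h' hv) (fun h'' => hvA ⟨h'', hv⟩) x hx.1 y hy.1⟩

theorem Mod.restrict' {S' : Set V} (h : Mod g S A) (h' : S' ⊆ S) (hA : A ⊆ S') : Mod g S' A :=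
  ⟨hA, fun v hv hvA x hx y hy => h.unif v (h' hv) hvA x hx y hy⟩

theorem Mod.inter (h : Mod g S A) (h' : Mod g S B) : Mod g S (A ∩ B) := by
  refine ⟨fun x hx => h.sub hx.1, fun v hv hvA x hx y hy => ?_⟩
  by_cases hv' : v ∈ A
  · exact h'.unif v hv (fun hB => hvA ⟨hv', hB⟩) x hx.2 y hy.2
  · exact h.unif v hv hv' x hx.1 y hy.1

theorem Mod.union (h : Mod g S A) (h' : Mod g S B) (hne : (A ∩ B).Nonempty) :
    Mod g S (A ∪ B) := by
  obtain ⟨z, hzA, hzB⟩ := hne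
  refine ⟨Set.union_subset h.sub h'.sub, fun v hv hvA => ?_⟩
  have key : ∀ x ∈ A ∪ B, (g.adj v x ↔ g.adj v z) := by
    rintro x (hx | hx)
    · exact h.unif v hv (fun e => hvA (Or.inl e)) x hx z hzA
    · exact h'.unif v hv (fun e => hvA (Or.inr e)) x hx z hzB
  intro x hx y hy
  rw [key x hx, key y hy]

theorem Mod.overlap (h : Mod g S A) (h' : Mod g S B) (hne : (A ∩ B).Nonempty)
    (hu : A ∪ B = S) (hA : A ≠ S) (hB : B ≠ S) :
    Split g S A (S \ A) ∨ Split g.dual S A (S \ A) := by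
  have neA : A.Nonempty := hne.mono Set.inter_subset_left
  have ne2 : (S \ A).Nonempty := by
    by_contra hcon
    rw [Set.not_nonempty_iff_eq_empty, Set.sdiff_eq_empty] at hcon
    exact hA (h.sub.antisymm hcon)
  have hsub : S \ A ⊆ B := by
    rintro x ⟨hx, hxA⟩
    rw [← hu] at hx
    exact hx.resolve_left hxA
  have hex : ∃ x, x ∈ A ∧ x ∉ B := by
    by_contra hcon
    push Not at hcon
    apply hB
    rw [← hu]
    exact (Set.union_eq_right.mpr hcon).symm
  obtain ⟨x0, hx0, hx0B⟩ := hex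
  obtain ⟨v0, hv0⟩ := ne2
  have key : ∀ x ∈ A, ∀ v ∈ S \ A, (g.adj x v ↔ g.adj x0 v0) := by
    intro x hx v hv
    rw [LG.comm, h.unif v hv.1 hv.2 x hx x0 hx0, LG.comm]
    exact h'.unif x0 (h.sub hx0) hx0B v (hsub hv) v0 (hsub hv0)
  have hun : A ∪ S \ A = S := Set.union_sdiff_cancel h.sub
  by_cases hb : g.adj x0 v0
  · right
    exact Split.mk_dual hun Set.disjoint_sdiff_right neA ⟨v0, hv0⟩ fun x hx v hv => (key x hx v hv).mpr hb
  · left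
    exact ⟨hun, Set.disjoint_sdiff_right, neA, ⟨v0, hv0⟩, fun x hx v hv hxv => hb ((key x hx v hv).mp hxv)⟩

/-- Presentation of `S` by a prime graph. -/
structure Pres (g : LG V) (S : Set V) (P : LGraph) (c : V → P.V) : Prop where
  prime : P.Prime
  card : 4 ≤ Fintype.card P.V
  surj : ∀ p, ∃ x ∈ S, c x = p
  adj : ∀ x ∈ S, ∀ y ∈ S, c x ≠ c y → (g.adj x y ↔ P.adj (c x) (c y))

theorem isModule_dual {P : LGraph} {M : Set P.V} (h : P.dual.IsModule M) : P.IsModule M := by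
  intro v hv x hx y hy
  have h1 : v ≠ x := fun e => hv (e ▸ hx)
  have h2 : v ≠ y := fun e => hv (e ▸ hy)
  have h3 : (v ≠ x ∧ ¬ P.adj v x) ↔ (v ≠ y ∧ ¬ P.adj v y) := h v hv x hx y hy
  tauto

theorem prime_dual {P : LGraph} (h : P.Prime) : P.dual.Prime :=
  ⟨h.1, fun M hM => h.2 M (isModule_dual hM)⟩

theorem Pres.dual {P : LGraph} {c : V → P.V} (h : Pres g S P c) : Pres g.dual S P.dual c := by
  refine ⟨prime_dual h.prime, h.card, h.surj, fun x hx y hy hne => ?_⟩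
  change (x ≠ y ∧ ¬ g.adj x y) ↔ (c x ≠ c y ∧ ¬ P.adj (c x) (c y))
  rw [h.adj x hx y hy hne]
  exact and_congr_left fun _ => ⟨fun _ => hne, fun _ e => hne (congrArg c e)⟩

theorem Pres.of_dual {P : LGraph} {c : V → P.V} (h : Pres g.dual S P c) : Pres g S P.dual c := by
  have := h.dual
  rw [LG.dual_dual] at this
  exact this

theorem Pres.ex3 {P : LGraph} {c : V → P.V} (h : Pres g S P c) (p q : P.V) :
    ∃ r, r ≠ p ∧ r ≠ q := by
  classical
  have : ({p, q} : Finset P.V).card < Fintype.card P.V :=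
    lt_of_le_of_lt (Finset.card_le_two) (by have := h.card; omega)
  obtain ⟨r, hr⟩ := Finset.exists_mem_notMem_of_card_lt_card (s := {p, q}) (t := Finset.univ)
    (by simpa using this)
  exact ⟨r, by simpa using hr⟩

theorem Pres.lemmaU {P : LGraph} {c : V → P.V} (h : Pres g S P c) (hA : Mod g S A)
    (hne : A.Nonempty) : (∃ p, ∀ x ∈ A, c x = p) ∨ A = S := by
  have hM : P.IsModule (c '' A) := by
    rintro v hv _ ⟨x, hx, rfl⟩ _ ⟨y, hy, rfl⟩
    obtain ⟨s, hs, rfl⟩ := h.surj v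
    have hsA : s ∉ A := fun e => hv ⟨s, e, rfl⟩
    have h1 : c s ≠ c x := fun e => hv ⟨x, hx, e.symm⟩
    have h2 : c s ≠ c y := fun e => hv ⟨y, hy, e.symm⟩
    rw [← h.adj s hs x (hA.sub hx) h1, ← h.adj s hs y (hA.sub hy) h2]
    exact hA.unif s hs hsA x hx y hy
  rcases h.prime.2 _ hM with h0 | ⟨v, h1⟩ | h2
  · rw [Set.image_eq_empty] at h0
    exact (hne.ne_empty h0).elim
  · left
    refine ⟨v, fun x hx => ?_⟩
    have : c x ∈ c '' A := ⟨x, hx, rfl⟩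
    rw [h1] at this
    exact this
  · right
    refine hA.sub.antisymm fun s hs => ?_
    by_contra hsA
    obtain ⟨q, hq, -⟩ := h.ex3 (c s) (c s)
    obtain ⟨r, hr1, hr2⟩ := h.ex3 (c s) q
    have hM' : P.IsModule ({c s}ᶜ : Set P.V) := by
      intro v hv x hx y hy
      have hv : v = c s := by simpa using hv
      subst hv
      have hx' : x ∈ c '' A := by rw [h2]; trivial
      have hy' : y ∈ c '' A := by rw [h2]; trivial
      obtain ⟨a, ha, rfl⟩ := hx'
      obtain ⟨b, hb, rfl⟩ := hy'
      rw [← h.adj s hs a (hA.sub ha) (fun e => hx e.symm),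
        ← h.adj s hs b (hA.sub hb) (fun e => hy e.symm)]
      exact hA.unif s hs hsA a ha b hb
    rcases h.prime.2 _ hM' with h0 | ⟨v, h1⟩ | h3
    · have : q ∈ ({c s}ᶜ : Set P.V) := hq
      rw [h0] at this
      exact this
    · have e1 : q ∈ ({c s}ᶜ : Set P.V) := hq
      have e2 : r ∈ ({c s}ᶜ : Set P.V) := hr1
      rw [h1] at e1 e2
      exact hr2 (e2.trans e1.symm)
    · have : c s ∈ ({c s}ᶜ : Set P.V) := by rw [h3]; trivial
      exact this rfl

theorem Pres.not_split {P : LGraph} {c : V → P.V} (h : Pres g S P c) (h' : Split g S A B) :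
    False := by
  have hA : A ≠ S := by
    intro e
    obtain ⟨b, hb⟩ := h'.neB
    exact h'.ne (e ▸ h'.subB hb) hb
  have hB : B ≠ S := by
    intro e
    obtain ⟨a, ha⟩ := h'.neA
    exact h'.ne ha (e ▸ h'.subA ha)
  obtain ⟨p, hp⟩ := (h.lemmaU h'.modA h'.neA).resolve_right hA
  obtain ⟨q, hq⟩ := (h.lemmaU h'.swap.modA h'.neB).resolve_right hB
  obtain ⟨r, hr1, hr2⟩ := h.ex3 p q
  obtain ⟨x, hx, rfl⟩ := h.surj r
  rw [← h'.un] at hx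
  rcases hx with hx | hx
  · exact hr1 (hp x hx)
  · exact hr2 (hq x hx)

theorem Pres.not_cosplit {P : LGraph} {c : V → P.V} (h : Pres g S P c)
    (h' : Split g.dual S A B) : False := h.dual.not_split h'

theorem Pres.not_subsingleton {P : LGraph} {c : V → P.V} (h : Pres g S P c) {v : V}
    (h' : S ⊆ {v}) : False := by
  obtain ⟨r, hr1, hr2⟩ := h.ex3 (c v) (c v)
  obtain ⟨x, hx, rfl⟩ := h.surj r
  exact hr1 (congrArg c (h' hx))

theorem Pres.nonempty {P : LGraph} {c : V → P.V} (h : Pres g S P c) : S.Nonempty := by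
  have h1 := h.card
  have : Nonempty P.V := Fintype.card_pos_iff.mp (by omega)
  obtain ⟨x, hx, -⟩ := h.surj this.some
  exact ⟨x, hx⟩

/-- The fiber over `p`. -/
abbrev fib {X : Type} (S : Set V) (c : V → X) (p : X) : Set V := S ∩ c ⁻¹' {p}

theorem Pres.fib_nonempty {P : LGraph} {c : V → P.V} (h : Pres g S P c) (p : P.V) :
    (fib S c p).Nonempty := by
  obtain ⟨x, hx, e⟩ := h.surj p
  exact ⟨x, hx, e⟩

theorem Pres.mod_fib {P : LGraph} {c : V → P.V} (h : Pres g S P c) (p : P.V) :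
    Mod g S (fib S c p) := by
  refine ⟨Set.inter_subset_left, ?_⟩
  rintro v hv hvA x ⟨hx, hx'⟩ y ⟨hy, hy'⟩
  have hvp : c v ≠ p := fun e => hvA ⟨hv, e⟩
  have hx' : c x = p := hx'
  have hy' : c y = p := hy'
  rw [h.adj v hv x hx (by rw [hx']; exact hvp), h.adj v hv y hy (by rw [hy']; exact hvp), hx', hy']

theorem Pres.fib_ne {P : LGraph} {c : V → P.V} (h : Pres g S P c) (p : P.V) :
    fib S c p ≠ S := by
  intro e
  obtain ⟨r, hr1, hr2⟩ := h.ex3 p p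
  obtain ⟨x, hx, rfl⟩ := h.surj r
  rw [← e] at hx
  exact hr1 hx.2

theorem Pres.fib_ssub {P : LGraph} {c : V → P.V} (h : Pres g S P c) (p : P.V) :
    fib S c p ⊂ S := Set.inter_subset_left.ssubset_of_ne (h.fib_ne p)

theorem Pres.uniq1 {P P' : LGraph} {c : V → P.V} {c' : V → P'.V} (h : Pres g S P c)
    (h' : Pres g S P' c') {x y : V} (hx : x ∈ S) (hy : y ∈ S) (e : c x = c y) : c' x = c' y := by
  obtain ⟨p, hp⟩ := (h'.lemmaU (h.mod_fib (c x)) (h.fib_nonempty _)).resolve_right (h.fib_ne _)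
  rw [hp x ⟨hx, rfl⟩, hp y ⟨hy, e.symm⟩]

theorem Pres.equiv {P P' : LGraph} {c : V → P.V} {c' : V → P'.V} (h : Pres g S P c)
    (h' : Pres g S P' c') : ∃ e : P.V ≃ P'.V, (∀ x ∈ S, e (c x) = c' x) ∧
      ∀ v w, P.adj v w ↔ P'.adj (e v) (e w) := by
  choose s hs hcs using h.surj
  choose s' hs' hcs' using h'.surj
  have h1 : ∀ x ∈ S, c' (s (c x)) = c' x := fun x hx => h.uniq1 h' (hs _) hx (hcs _)
  have h2 : ∀ x ∈ S, c (s' (c' x)) = c x := fun x hx => h'.uniq1 h (hs' _) hx (hcs' _)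
  have hl : ∀ p, c (s' (c' (s p))) = p := fun p => by rw [h2 _ (hs p), hcs]
  have hr : ∀ p, c' (s (c (s' p))) = p := fun p => by rw [h1 _ (hs' p), hcs']
  refine ⟨⟨fun p => c' (s p), fun p => c (s' p), hl, hr⟩, h1, fun v w => ?_⟩
  change P.adj v w ↔ P'.adj (c' (s v)) (c' (s w))
  by_cases hvw : v = w
  · subst hvw
    exact ⟨fun h => (P.irrefl _ h).elim, fun h => (P'.irrefl _ h).elim⟩
  · have e1 : c (s v) ≠ c (s w) := by rw [hcs, hcs]; exact hvw
    have e2 : c' (s v) ≠ c' (s w) := fun e => e1 (h'.uniq1 h (hs _) (hs _) e)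
    rw [← h'.adj _ (hs v) _ (hs w) e2, h.adj _ (hs v) _ (hs w) e1, hcs, hcs]

end part3

section part4
open LGraph

variable {V : Type} {g : LG V} {S A B : Set V}

/-- Small primes give splits. -/
theorem card_four {P : LGraph} {c : V → P.V} (hP : P.Prime) (surj : ∀ p, ∃ x ∈ S, c x = p)
    (adj : ∀ x ∈ S, ∀ y ∈ S, c x ≠ c y → (g.adj x y ↔ P.adj (c x) (c y)))
    (h1 : ∀ A B, ¬ Split g S A B) (h2 : ∀ A B, ¬ Split g.dual S A B) :
    4 ≤ Fintype.card P.V := by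
  classical
  by_contra hcon
  have h2' := hP.1
  have h23 : Fintype.card P.V = 2 ∨ Fintype.card P.V = 3 := by omega
  rcases h23 with hc | hc
  · rw [← Finset.card_univ, Finset.card_eq_two] at hc
    obtain ⟨p, q, hpq, hu⟩ := hc
    have hall : ∀ r, r = p ∨ r = q := fun r => by
      have : r ∈ (Finset.univ : Finset P.V) := Finset.mem_univ _
      rw [hu] at this
      simpa using this
    obtain ⟨x0, hx0, hxp⟩ := surj p
    obtain ⟨y0, hy0, hyq⟩ := surj q
    have hun : fib S c p ∪ fib S c q = S := by
      ext x
      constructor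
      · rintro (hx | hx) <;> exact hx.1
      · intro hx
        rcases hall (c x) with h | h
        · exact Or.inl ⟨hx, h⟩
        · exact Or.inr ⟨hx, h⟩
    have hdis : Disjoint (fib S c p) (fib S c q) := by
      rw [Set.disjoint_left]
      rintro x ⟨_, hx⟩ ⟨_, hx'⟩
      exact hpq ((show c x = p from hx).symm.trans hx')
    have hadj : ∀ x ∈ fib S c p, ∀ y ∈ fib S c q, (g.adj x y ↔ P.adj p q) := by
      rintro x ⟨hx, hx'⟩ y ⟨hy, hy'⟩
      have hx' : c x = p := hx'
      have hy' : c y = q := hy'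
      rw [adj x hx y hy (by rw [hx', hy']; exact hpq), hx', hy']
    by_cases hb : P.adj p q
    · exact h2 _ _ (Split.mk_dual hun hdis ⟨x0, hx0, hxp⟩ ⟨y0, hy0, hyq⟩
        fun x hx y hy => (hadj x hx y hy).mpr hb)
    · exact h1 _ _ ⟨hun, hdis, ⟨x0, hx0, hxp⟩, ⟨y0, hy0, hyq⟩,
        fun x hx y hy hxy => hb ((hadj x hx y hy).mp hxy)⟩
  · rw [← Finset.card_univ, Finset.card_eq_three] at hc
    obtain ⟨x, y, z, hxy, hxz, hyz, hu⟩ := hc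
    have hall : ∀ r, r = x ∨ r = y ∨ r = z := fun r => by
      have : r ∈ (Finset.univ : Finset P.V) := Finset.mem_univ _
      rw [hu] at this
      simpa using this
    have key : ∀ a b d : P.V, a ≠ b → a ≠ d → b ≠ d → (∀ r, r = a ∨ r = b ∨ r = d) →
        ¬ (P.adj a b ↔ P.adj a d) := by
      intro a b d hab had hbd hall h
      have hM : P.IsModule ({b, d} : Set P.V) := by
        intro v hv
        have hva : v = a := by
          rcases hall v with h | h | h
          · exact h
          · exact (hv (Or.inl h)).elim
          · exact (hv (Or.inr h)).elim
        subst hva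
        rintro x (rfl | rfl) y (rfl | rfl)
        · exact Iff.rfl
        · exact h
        · exact h.symm
        · exact Iff.rfl
      have hb : b ∈ ({b, d} : Set P.V) := Or.inl rfl
      have hd : d ∈ ({b, d} : Set P.V) := Or.inr rfl
      rcases hP.2 _ hM with h0 | ⟨v, h1⟩ | h3
      · rw [h0] at hb
        exact hb
      · rw [h1] at hb hd
        exact hbd (hb.trans hd.symm)
      · have : a ∈ ({b, d} : Set P.V) := by rw [h3]; trivial
        rcases this with h | h
        · exact hab h
        · exact had h
    have c1 := key x y z hxy hxz hyz hall
    have c2 := key y x z hxy.symm hyz hxz (fun r => by have := hall r; tauto)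
    have c3 := key z x y hxz.symm hyz.symm hxy (fun r => by have := hall r; tauto)
    have s1 : P.adj x y ↔ P.adj y x := ⟨fun h => P.symm h, fun h => P.symm h⟩
    have s2 : P.adj x z ↔ P.adj z x := ⟨fun h => P.symm h, fun h => P.symm h⟩
    have s3 : P.adj y z ↔ P.adj z y := ⟨fun h => P.symm h, fun h => P.symm h⟩
    tauto

theorem exists_pres [Finite V] (g : LG V) (S : Set V) :
    S = ∅ ∨ (∃ v, S = {v}) ∨ (∃ A B, Split g S A B) ∨ (∃ A B, Split g.dual S A B) ∨
      ∃ (P : LGraph) (c : V → P.V), Pres g S P c := by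
  classical
  by_contra hcon
  push Not at hcon
  obtain ⟨h0, h1, h2, h3, h4⟩ := hcon
  let MM : Set (Set V) := {A | Mod g S A ∧ A ≠ S ∧ A.Nonempty}
  have hmax : ∀ v ∈ S, ∃ A, Maximal (· ∈ MM) A ∧ v ∈ A := by
    intro v hv
    have hvM : ({v} : Set V) ∈ MM := by
      refine ⟨⟨by simpa using hv, ?_⟩, fun e => h1 v e.symm, ⟨v, rfl⟩⟩
      rintro w _ _ x rfl y rfl
      exact Iff.rfl
    obtain ⟨A, hA1, hA2⟩ := Set.Finite.exists_le_maximal (Set.toFinite MM) hvM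
    exact ⟨A, hA2, hA1 rfl⟩
  have hdisj : ∀ A B, Maximal (· ∈ MM) A → Maximal (· ∈ MM) B → ∀ x, x ∈ A → x ∈ B → A = B := by
    intro A B hA hB x hxA hxB
    have hmA := hA.prop.1
    have hmB := hB.prop.1
    by_cases hu : A ∪ B = S
    · rcases hmA.overlap hmB ⟨x, hxA, hxB⟩ hu hA.prop.2.1 hB.prop.2.1 with h | h
      · exact (h2 _ _ h).elim
      · exact (h3 _ _ h).elim
    · have hM : A ∪ B ∈ MM := ⟨hmA.union hmB ⟨x, hxA, hxB⟩, hu, ⟨x, Or.inl hxA⟩⟩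
      have e1 : A ∪ B ⊆ A := hA.2 hM Set.subset_union_left
      have e2 : A ∪ B ⊆ B := hB.2 hM Set.subset_union_right
      exact (Set.subset_union_left.trans e2).antisymm (Set.subset_union_right.trans e1)
  choose! m hm hvm using hmax
  obtain ⟨v0, hv0⟩ := h0
  let P : LGraph :=
    { V := {A : Set V // Maximal (· ∈ MM) A}
      fintype := Fintype.ofFinite _
      adj := fun A B => A ≠ B ∧ ∃ x ∈ A.1, ∃ y ∈ B.1, g.adj x y
      symm := by
        rintro A B ⟨hne, x, hx, y, hy, h⟩
        exact ⟨hne.symm, y, hy, x, hx, g.symm h⟩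
      irrefl := fun A h => h.1 rfl
      label := fun _ => (0, true) }
  let c : V → P.V := fun v => if h : v ∈ S then ⟨m v, hm v h⟩ else ⟨m v0, hm v0 hv0⟩
  have hc : ∀ v (h : v ∈ S), c v = ⟨m v, hm v h⟩ := fun v h => dif_pos h
  have hc' : ∀ v, v ∈ S → ∀ A : P.V, v ∈ A.1 → c v = A := by
    intro v h A hA
    rw [hc v h]
    exact Subtype.ext (hdisj _ _ (hm v h) A.2 v (hvm v h) hA)
  have hcmem : ∀ v, v ∈ S → v ∈ (c v).1 := by
    intro v h
    rw [hc v h]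
    exact hvm v h
  have hsubS : ∀ A : P.V, A.1 ⊆ S := fun A => A.2.prop.1.sub
  have hadj : ∀ (A B : P.V), A ≠ B → ∀ x ∈ A.1, ∀ y ∈ B.1, (g.adj x y ↔ P.adj A B) := by
    intro A B hne x hx y hy
    constructor
    · intro h
      exact ⟨hne, x, hx, y, hy, h⟩
    · rintro ⟨_, x', hx', y', hy', h⟩
      have n1 : x' ∉ B.1 := fun e => hne (Subtype.ext (hdisj _ _ A.2 B.2 x' hx' e))
      have n2 : y ∉ A.1 := fun e => hne (Subtype.ext (hdisj _ _ A.2 B.2 y e hy))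
      have e1 := (B.2.prop.1.unif x' (hsubS A hx') n1 y' hy' y hy).mp h
      have e2 := (A.2.prop.1.unif y (hsubS B hy) n2 x' hx' x hx).mp (g.symm e1)
      exact g.symm e2
  have surj : ∀ p, ∃ x ∈ S, c x = p := by
    intro p
    obtain ⟨x, hx⟩ := p.2.prop.2.2
    exact ⟨x, hsubS p hx, hc' x (hsubS p hx) p hx⟩
  have hP : P.Prime := by
    constructor
    · refine (@Fintype.one_lt_card_iff P.V P.fintype).mpr ?_
      have : ∃ w ∈ S, w ∉ m v0 := by
        by_contra hcon
        push Not at hcon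
        exact (hm v0 hv0).prop.2.1 ((hm v0 hv0).prop.1.sub.antisymm hcon)
      obtain ⟨w, hw, hw'⟩ := this
      refine ⟨c v0, c w, fun e => hw' ?_⟩
      have := hcmem w hw
      rw [← e, hc v0 hv0] at this
      exact this
    · intro M hM
      by_contra hcon
      push Not at hcon
      obtain ⟨n0, n1, n2⟩ := hcon
      obtain ⟨A, hA⟩ := n0
      have hex : ∃ B ∈ M, B ≠ A := by
        by_contra hcon
        push Not at hcon
        exact n1 A (Set.eq_singleton_iff_unique_mem.mpr ⟨hA, hcon⟩)
      obtain ⟨B, hB, hBA⟩ := hex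
      have hex : ∃ D, D ∉ M := by
        by_contra hcon
        push Not at hcon
        exact n2 (Set.eq_univ_of_forall hcon)
      obtain ⟨D, hD⟩ := hex
      let U : Set V := {x | ∃ E ∈ M, x ∈ E.1}
      have hU : U ∈ MM := by
        refine ⟨⟨?_, ?_⟩, ?_, ?_⟩
        · rintro x ⟨E, _, hx⟩
          exact hsubS E hx
        · rintro v hv hvU x ⟨E, hE, hx⟩ y ⟨F, hF, hy⟩
          have hvM : c v ∉ M := fun e => hvU ⟨c v, e, hcmem v hv⟩
          have ne1 : c v ≠ E := fun e => hvM (e ▸ hE)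
          have ne2 : c v ≠ F := fun e => hvM (e ▸ hF)
          rw [hadj (c v) E ne1 v (hcmem v hv) x hx, hadj (c v) F ne2 v (hcmem v hv) y hy]
          exact hM (c v) hvM E hE F hF
        · intro e
          obtain ⟨x, hx⟩ := D.2.prop.2.2
          have : x ∈ U := by rw [e]; exact hsubS D hx
          obtain ⟨E, hE, hxE⟩ := this
          have : D = E := Subtype.ext (hdisj _ _ D.2 E.2 x hx hxE)
          exact hD (this ▸ hE)
        · obtain ⟨x, hx⟩ := A.2.prop.2.2
          exact ⟨x, A, hA, hx⟩
      have hsub : U ⊆ A.1 := A.2.2 hU fun x hx => ⟨A, hA, hx⟩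
      obtain ⟨x, hx⟩ := B.2.prop.2.2
      exact hBA (Subtype.ext (hdisj _ _ B.2 A.2 x hx (hsub ⟨B, hB, hx⟩)))
  have hadj' : ∀ x ∈ S, ∀ y ∈ S, c x ≠ c y → (g.adj x y ↔ P.adj (c x) (c y)) :=
    fun x hx y hy hne => hadj _ _ hne x (hcmem x hx) y (hcmem y hy)
  exact h4 P c ⟨hP, card_four hP surj hadj' (fun A B => h2 A B) (fun A B => h3 A B), surj, hadj'⟩

theorem Split.mod_cases (h : Split g S B (S \ B)) (hA : Mod g S A) (hne : A.Nonempty) (hS : A ≠ S) :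
    Split g S A (S \ A) ∨ (∃ G1 G2, Split g S G1 G2 ∧ A ⊂ G1) := by
  have hne2 : (S \ A).Nonempty := by
    by_contra hcon
    rw [Set.not_nonempty_iff_eq_empty, Set.sdiff_eq_empty] at hcon
    exact hS (hA.sub.antisymm hcon)
  have hBS : ∀ x ∈ S, x ∈ B ∨ x ∈ S \ B := fun x hx => by
    by_cases hB : x ∈ B
    · exact Or.inl hB
    · exact Or.inr ⟨hx, hB⟩
  by_cases hm1 : (A ∩ B).Nonempty
  · by_cases hm2 : (A ∩ (S \ B)).Nonempty
    · left
      refine ⟨Set.union_sdiff_cancel hA.sub, Set.disjoint_sdiff_right, hne, hne2, ?_⟩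
      obtain ⟨a, haA, haB⟩ := hm1
      obtain ⟨b, hbA, hbB⟩ := hm2
      intro x hx v hv hxv
      have hxv := g.symm hxv
      rcases hBS v hv.1 with hvB | hvB
      · exact h.no v hvB b hbB ((hA.unif v hv.1 hv.2 x hx b hbA).mp hxv)
      · exact h.no a haB v hvB (g.symm ((hA.unif v hv.1 hv.2 x hx a haA).mp hxv))
    · have hsub : A ⊆ B := fun x hx => by
        by_contra hxB
        exact hm2 ⟨x, hx, hA.sub hx, hxB⟩
      by_cases e : A = B
      · left
        rw [e]; exact h
      · exact Or.inr ⟨B, S \ B, h, hsub.ssubset_of_ne e⟩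
  · have hsub : A ⊆ S \ B := fun x hx => ⟨hA.sub hx, fun hB => hm1 ⟨x, hx, hB⟩⟩
    by_cases e : A = S \ B
    · left
      have e2 : S \ A = B := by
        rw [e]
        exact Set.sdiff_sdiff_cancel_left h.subA
      rw [e2, e]
      exact h.swap
    · exact Or.inr ⟨S \ B, B, h.swap, hsub.ssubset_of_ne e⟩

theorem Split.eq_diff (h : Split g S A B) : B = S \ A := by
  ext x
  constructor
  · intro hx
    exact ⟨h.subB hx, fun hA => h.ne hA hx⟩
  · rintro ⟨hx, hxA⟩
    rw [← h.un] at hx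
    exact hx.resolve_left hxA

theorem mod_cases [Finite V] (hA : Mod g S A) (hne : A.Nonempty) (hS : A ≠ S) :
    (Split g S A (S \ A) ∨ ∃ G1 G2, Split g S G1 G2 ∧ A ⊂ G1) ∨
    (Split g.dual S A (S \ A) ∨ ∃ G1 G2, Split g.dual S G1 G2 ∧ A ⊂ G1) ∨
    (∃ (P : LGraph) (c : V → P.V) (p : P.V), Pres g S P c ∧ A ⊆ fib S c p) := by
  rcases exists_pres g S with h | ⟨v, h⟩ | ⟨B, B', h⟩ | ⟨B, B', h⟩ | ⟨P, c, h⟩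
  · subst h
    exact (hS (Set.subset_empty_iff.mp hA.sub)).elim
  · subst h
    rcases Set.subset_singleton_iff_eq.mp hA.sub with h | h
    · exact (hne.ne_empty h).elim
    · exact (hS h).elim
  · left
    have e := h.eq_diff
    subst e
    exact h.mod_cases hA hne hS
  · right; left
    have e := h.eq_diff
    subst e
    exact h.mod_cases hA.dual hne hS
  · right; right
    obtain ⟨p, hp⟩ := (h.lemmaU hA hne).resolve_right hS
    exact ⟨P, c, p, h, fun x hx => ⟨hA.sub hx, hp x hx⟩⟩

end part4

section part5
open LGraph

variable {V : Type} [Finite V] {g : LG V} {S A B : Set V} {K K' : KQ}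

theorem ncard_lt (h : A ⊂ S) : A.ncard < S.ncard := Set.ncard_lt_ncard h (Set.toFinite _)

theorem Split.ssA {V : Type} {g : LG V} {S A B : Set V} (h : Split g S A B) : A ⊂ S := by
  refine h.subA.ssubset_of_ne fun e => ?_
  obtain ⟨b, hb⟩ := h.neB
  exact h.ne (e ▸ h.subB hb) hb

theorem Split.ssB {V : Type} {g : LG V} {S A B : Set V} (h : Split g S A B) : B ⊂ S := h.swap.ssA

theorem Pres.cofib_ssub {V : Type} {g : LG V} {S : Set V} {P : LGraph} {c : V → P.V}
    (h : Pres g S P c) (p : P.V) : S \ fib S c p ⊂ S := by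
  refine Set.sdiff_subset.ssubset_of_ne fun e => ?_
  obtain ⟨x, hx⟩ := h.fib_nonempty p
  have : x ∈ S \ fib S c p := by rw [e]; exact hx.1
  exact this.2 hx

/-- The semantics (interpretation of the graph `g` restricted to `S`). -/
def T {V : Type} [hfin : Finite V] (g : LG V) (S : Set V) (K : KQ) : Prop :=
  (S = ∅ → 0 ≤ K) ∧
  (∀ A B, (_h : Split g S A B) → ∀ x, T g.dual A x → T g B (K + x)) ∧
  (S.Nonempty → (∀ A B, ¬ Split g S A B) →
    ∃ k, k ≤ K ∧ (
      (∃ v, S = {v} ∧ k = mk (single (dualAtom (g.label v)))) ∨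
      (∃ A B, ∃ _h : Split g.dual S A B, ∃ u v, T g A u ∧ T g B v ∧ k = u + v) ∨
      (∃ (P : LGraph) (c : V → P.V), ∃ _h : Pres g S P c, ∃ κ : P.V → LGraph,
        (∀ p, Nonempty (κ p).V) ∧ (∀ p, T g (fib S c p) (mk (κ p))) ∧ k = mk (P.dual.comp κ)) ∨
      (∃ (P : LGraph) (c : V → P.V), ∃ _h : Pres g S P c, ∃ p u v,
        T g (fib S c p) u ∧ T g (S \ fib S c p) v ∧ k = u + v)))
termination_by S.ncard
decreasing_by
  · exact ncard_lt _h.ssA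
  · exact ncard_lt _h.ssB
  · exact ncard_lt _h.ssA
  · exact ncard_lt _h.ssB
  · exact ncard_lt (_h.fib_ssub _)
  · exact ncard_lt (_h.fib_ssub _)
  · exact ncard_lt (_h.cofib_ssub _)

theorem T_empty : T g ∅ K ↔ 0 ≤ K := by
  rw [T]
  constructor
  · intro h
    exact h.1 rfl
  · intro h
    refine ⟨fun _ => h, fun A B hs => ?_, fun h => (Set.not_nonempty_empty h).elim⟩
    obtain ⟨x, hx⟩ := hs.neA
    exact (hs.subA hx).elim

theorem T_empty' (hS : S = ∅) : T g S K ↔ 0 ≤ K := by subst hS; exact T_empty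

theorem T_split (h : Split g S A B) :
    T g S K ↔ ∀ A B, Split g S A B → ∀ x, T g.dual A x → T g B (K + x) := by
  rw [T]
  constructor
  · intro h'
    exact h'.2.1
  · intro h'
    refine ⟨?_, h', fun _ h'' => (h'' A B h).elim⟩
    rintro rfl
    obtain ⟨x, hx⟩ := h.neA
    exact (h.subA hx).elim

theorem not_split_single {v : V} (h : Split g {v} A B) : False := by
  obtain ⟨x, hx⟩ := h.neA
  obtain ⟨y, hy⟩ := h.neB
  have e1 : x = v := h.subA hx
  have e2 : y = v := h.subB hy
  subst e1 e2
  exact h.ne hx hy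

theorem T_nosplit (hne : S.Nonempty) (h : ∀ A B, ¬ Split g S A B) : T g S K ↔
    ∃ k, k ≤ K ∧ (
      (∃ v, S = {v} ∧ k = mk (single (dualAtom (g.label v)))) ∨
      (∃ A B, ∃ _h : Split g.dual S A B, ∃ u v, T g A u ∧ T g B v ∧ k = u + v) ∨
      (∃ (P : LGraph) (c : V → P.V), ∃ _h : Pres g S P c, ∃ κ : P.V → LGraph,
        (∀ p, Nonempty (κ p).V) ∧ (∀ p, T g (fib S c p) (mk (κ p))) ∧ k = mk (P.dual.comp κ)) ∨
      (∃ (P : LGraph) (c : V → P.V), ∃ _h : Pres g S P c, ∃ p u v,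
        T g (fib S c p) u ∧ T g (S \ fib S c p) v ∧ k = u + v)) := by
  rw [T]
  constructor
  · intro h'
    exact h'.2.2 hne h
  · intro h'
    exact ⟨fun e => (hne.ne_empty e).elim, fun A B hs => (h A B hs).elim, fun _ _ => h'⟩

theorem T_single {v : V} : T g {v} K ↔ mk (single (dualAtom (g.label v))) ≤ K := by
  rw [T_nosplit (Set.singleton_nonempty v) fun A B hs => not_split_single hs]
  constructor
  · rintro ⟨k, hk, ⟨w, hw, rfl⟩ | ⟨A, B, h, _⟩ | ⟨P, c, h, _⟩ | ⟨P, c, h, _⟩⟩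
    · rw [Set.singleton_eq_singleton_iff.mp hw]
      exact hk
    · exact (not_split_single h).elim
    · exact (h.not_subsingleton le_rfl).elim
    · exact (h.not_subsingleton le_rfl).elim
  · intro h
    exact ⟨_, h, Or.inl ⟨v, rfl, rfl⟩⟩

theorem T_le (h : T g S K) (hK : K ≤ K') : T g S K' := by
  induction hn : S.ncard using Nat.strong_induction_on generalizing g S K K' with
  | _ n ih =>
  rcases Set.eq_empty_or_nonempty S with rfl | hne
  · rw [T_empty] at h ⊢
    exact h.trans hK
  by_cases hs : ∃ A B, Split g S A B
  · obtain ⟨A, B, hs⟩ := hs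
    rw [T_split hs] at h ⊢
    intro A B hAB x hx
    exact ih _ (hn ▸ ncard_lt hAB.ssB) (h A B hAB x hx) (by gcongr) rfl
  · push Not at hs
    rw [T_nosplit hne hs] at h ⊢
    obtain ⟨k, hk, h⟩ := h
    exact ⟨k, hk.trans hK, h⟩

theorem T_tens_def (h : Split g.dual S A B) : T g S K ↔
    ∃ A B, Split g.dual S A B ∧ ∃ u v, T g A u ∧ T g B v ∧ u + v ≤ K := by
  rw [T_nosplit (h.neA.mono h.subA) fun A B hs => split_excl hs h]
  constructor
  · rintro ⟨k, hk, ⟨w, rfl, rfl⟩ | ⟨A, B, h, u, v, hu, hv, rfl⟩ | ⟨P, c, h', _⟩ | ⟨P, c, h', _⟩⟩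
    · exact (not_split_single h).elim
    · exact ⟨A, B, h, u, v, hu, hv, hk⟩
    · exact (h'.not_cosplit h).elim
    · exact (h'.not_cosplit h).elim
  · rintro ⟨A, B, h, u, v, hu, hv, hk⟩
    exact ⟨_, hk, Or.inr (Or.inl ⟨A, B, h, u, v, hu, hv, rfl⟩)⟩

/-- Complete join of possibly empty parts. -/
structure Join {V : Type} (g : LG V) (S A B : Set V) : Prop where
  un : A ∪ B = S
  disj : Disjoint A B
  full : ∀ x ∈ A, ∀ y ∈ B, g.adj x y

theorem Split.join {V : Type} {g : LG V} {S A B : Set V} (h : Split g.dual S A B) : Join g S A B := ⟨h.un, h.disj, h.full⟩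

theorem Split.join' {V : Type} {g : LG V} {S A B : Set V} (h : Split g S A B) : Join g.dual S A B := by
  have : Split g.dual.dual S A B := by rw [LG.dual_dual]; exact h
  exact this.join

theorem Join.sub {V : Type} {g : LG V} {S A B : Set V} {A' B' C : Set V} (h : Join g S A B) (hA : A' ⊆ A) (hB : B' ⊆ B) (hC : A' ∪ B' = C) :
    Join g C A' B' :=
  ⟨hC, h.disj.mono hA hB, fun x hx y hy => h.full x (hA hx) y (hB hy)⟩

theorem T_join_intro (h : Join g S A B) {u v : KQ} (hu : T g A u) (hv : T g B v) :
    T g S (u + v) := by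
  rcases Set.eq_empty_or_nonempty A with rfl | hA
  · rw [T_empty] at hu
    have e := h.un
    rw [Set.empty_union] at e
    subst e
    exact T_le hv (le_add_of_nonneg_left hu)
  rcases Set.eq_empty_or_nonempty B with rfl | hB
  · rw [T_empty] at hv
    have e := h.un
    rw [Set.union_empty] at e
    subst e
    exact T_le hu (le_add_of_nonneg_right hv)
  have hs : Split g.dual S A B := Split.mk_dual h.un h.disj hA hB h.full
  rw [T_tens_def hs]
  exact ⟨A, B, hs, u, v, hu, hv, le_rfl⟩

theorem T_join_elim (h : Join g S A B) (hK : T g S K) :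
    ∃ u v, T g A u ∧ T g B v ∧ u + v ≤ K := by
  induction hn : S.ncard using Nat.strong_induction_on generalizing S A B K with
  | _ n ih =>
  rcases Set.eq_empty_or_nonempty A with rfl | hA
  · have e := h.un
    rw [Set.empty_union] at e
    subst e
    exact ⟨0, K, T_empty.mpr le_rfl, hK, by rw [zero_add]⟩
  rcases Set.eq_empty_or_nonempty B with rfl | hB
  · have e := h.un
    rw [Set.union_empty] at e
    subst e
    exact ⟨K, 0, hK, T_empty.mpr le_rfl, by rw [add_zero]⟩
  have hs : Split g.dual S A B := Split.mk_dual h.un h.disj hA hB h.full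
  rw [T_tens_def hs] at hK
  obtain ⟨A0, B0, h0, u0, v0, hu0, hv0, hk⟩ := hK
  have e1 : (A0 ∩ A) ∪ (A0 ∩ B) = A0 := by
    rw [← Set.inter_union_distrib_left, h.un]
    exact Set.inter_eq_left.mpr h0.subA
  have e2 : (B0 ∩ A) ∪ (B0 ∩ B) = B0 := by
    rw [← Set.inter_union_distrib_left, h.un]
    exact Set.inter_eq_left.mpr h0.subB
  have e3 : (A0 ∩ A) ∪ (B0 ∩ A) = A := by
    rw [← Set.union_inter_distrib_right, h0.un]
    exact Set.inter_eq_right.mpr hs.subA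
  have e4 : (A0 ∩ B) ∪ (B0 ∩ B) = B := by
    rw [← Set.union_inter_distrib_right, h0.un]
    exact Set.inter_eq_right.mpr hs.subB
  obtain ⟨u1, v1, hu1, hv1, hk1⟩ := ih _ (hn ▸ ncard_lt h0.ssA)
    (h.sub Set.inter_subset_right Set.inter_subset_right e1) hu0 rfl
  obtain ⟨u2, v2, hu2, hv2, hk2⟩ := ih _ (hn ▸ ncard_lt h0.ssB)
    (h.sub Set.inter_subset_right Set.inter_subset_right e2) hv0 rfl
  refine ⟨u1 + u2, v1 + v2, ?_, ?_, ?_⟩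
  · exact T_join_intro (h0.join.sub Set.inter_subset_left Set.inter_subset_left e3) hu1 hu2
  · exact T_join_intro (h0.join.sub Set.inter_subset_left Set.inter_subset_left e4) hv1 hv2
  · rw [add_add_add_comm]
    exact (add_le_add hk1 hk2).trans hk

theorem T_par_elim (un : A ∪ B = S) (disj : Disjoint A B) (no : ∀ x ∈ A, ∀ y ∈ B, ¬ g.adj x y)
    (hB : B.Nonempty) (hK : T g S K) {x : KQ} (hx : T g.dual A x) : T g B (K + x) := by
  rcases Set.eq_empty_or_nonempty A with rfl | hA
  · rw [T_empty] at hx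
    rw [Set.empty_union] at un
    subst un
    exact T_le hK (le_add_of_nonneg_right hx)
  have hs : Split g S A B := ⟨un, disj, hA, hB, no⟩
  exact (T_split hs).mp hK A B hs x hx

theorem Split.elim (h : Split g S A B) (hK : T g S K) {x : KQ} (hx : T g.dual A x) :
    T g B (K + x) := (T_split h).mp hK A B h x hx

theorem T_par_intro (h : Split g S A B) (h1 : ∀ x, T g.dual A x → T g B (K + x))
    (h2 : ∀ x, T g.dual B x → T g A (K + x)) : T g S K := by
  induction hn : S.ncard using Nat.strong_induction_on generalizing S A B K with
  | _ n ih =>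
  rw [T_split h]
  intro A' B' h' x hx
  have e1 : (A' ∩ A) ∪ (A' ∩ B) = A' := by
    rw [← Set.inter_union_distrib_left, h.un]
    exact Set.inter_eq_left.mpr h'.subA
  have e2 : (B' ∩ A) ∪ (B' ∩ B) = B' := by
    rw [← Set.inter_union_distrib_left, h.un]
    exact Set.inter_eq_left.mpr h'.subB
  have e3 : (A' ∩ A) ∪ (B' ∩ A) = A := by
    rw [← Set.union_inter_distrib_right, h'.un]
    exact Set.inter_eq_right.mpr h.subA
  have e4 : (A' ∩ B) ∪ (B' ∩ B) = B := by
    rw [← Set.union_inter_distrib_right, h'.un]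
    exact Set.inter_eq_right.mpr h.subB
  obtain ⟨x1, x2, hx1, hx2, hle⟩ := T_join_elim
    (h.join'.sub Set.inter_subset_right Set.inter_subset_right e1) hx
  -- the two key facts
  have f1 : (B' ∩ B).Nonempty → ∀ y, T g.dual (B' ∩ A) y → T g (B' ∩ B) (K + x + y) := by
    intro hne y hy
    have t1 : T g.dual A (x1 + y) := T_join_intro
      (h'.join'.sub Set.inter_subset_left Set.inter_subset_left e3) hx1 hy
    have t2 := T_par_elim e4 (h'.disj.mono Set.inter_subset_left Set.inter_subset_left)
      (fun a ha b hb => h'.no a ha.1 b hb.1) hne (h1 _ t1) hx2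
    refine T_le t2 ?_
    have : K + (x1 + y) + x2 = K + (x1 + x2) + y := by abel
    rw [this]
    gcongr
  have f2 : (B' ∩ A).Nonempty → ∀ y, T g.dual (B' ∩ B) y → T g (B' ∩ A) (K + x + y) := by
    intro hne y hy
    have t1 : T g.dual B (x2 + y) := T_join_intro
      (h'.join'.sub Set.inter_subset_left Set.inter_subset_left e4) hx2 hy
    have t2 := T_par_elim e3 (h'.disj.mono Set.inter_subset_left Set.inter_subset_left)
      (fun a ha b hb => h'.no a ha.1 b hb.1) hne (h2 _ t1) hx1
    refine T_le t2 ?_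
    have : K + (x2 + y) + x1 = K + (x1 + x2) + y := by abel
    rw [this]
    gcongr
  rcases Set.eq_empty_or_nonempty (B' ∩ A) with hA | hA
  · rw [hA, Set.empty_union] at e2
    have hB : (B' ∩ B).Nonempty := by rw [e2]; exact h'.neB
    have := f1 hB 0 (by rw [hA]; exact T_empty.mpr le_rfl)
    rwa [e2, add_zero] at this
  rcases Set.eq_empty_or_nonempty (B' ∩ B) with hB | hB
  · rw [hB, Set.union_empty] at e2
    have := f2 hA 0 (by rw [hB]; exact T_empty.mpr le_rfl)
    rwa [e2, add_zero] at this
  have hs : Split g B' (B' ∩ A) (B' ∩ B) :=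
    ⟨e2, h.disj.mono Set.inter_subset_right Set.inter_subset_right, hA, hB,
      fun a ha b hb => h.no a ha.2 b hb.2⟩
  exact ih _ (hn ▸ ncard_lt h'.ssB) hs (f1 hB) (f2 hA) rfl

theorem T_prime {P : LGraph} {c : V → P.V} (h : Pres g S P c) : T g S K ↔
    (∃ κ : P.V → LGraph, (∀ p, Nonempty (κ p).V) ∧ (∀ p, T g (fib S c p) (mk (κ p))) ∧
      mk (P.dual.comp κ) ≤ K) ∨
    (∃ p u v, T g (fib S c p) u ∧ T g (S \ fib S c p) v ∧ u + v ≤ K) := by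
  rw [T_nosplit h.nonempty fun A B hs => h.not_split hs]
  constructor
  · rintro ⟨k, hk, ⟨w, hw, rfl⟩ | ⟨A, B, h', _⟩ | ⟨P', c', h', κ, h1, h2, rfl⟩ |
      ⟨P', c', h', p, u, v, hu, hv, rfl⟩⟩
    · exact (h.not_subsingleton hw.subset).elim
    · exact (h.not_cosplit h').elim
    · obtain ⟨e, he, hadj⟩ := h.equiv h'
      have hf : ∀ p, fib S c' (e p) = fib S c p := by
        intro p
        ext x
        constructor
        · rintro ⟨hx, hx'⟩
          refine ⟨hx, e.injective ?_⟩
          rw [he x hx]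
          exact hx'
        · rintro ⟨hx, hx'⟩
          refine ⟨hx, ?_⟩
          have hx' : c x = p := hx'
          change c' x = e p
          rw [← he x hx, hx']
      left
      refine ⟨fun p => κ (e p), fun p => h1 _, fun p => ?_, ?_⟩
      · rw [← hf p]
        exact h2 _
      · refine le_trans (le_of_eq (mk_eq ?_)) hk
        refine comp_equiv P.dual P'.dual e (fun v w => ?_) κ
        change (v ≠ w ∧ ¬ P.adj v w) ↔ (e v ≠ e w ∧ ¬ P'.adj (e v) (e w))
        exact and_congr (e.injective.ne_iff).symm (not_congr (hadj v w))
    · obtain ⟨e, he, hadj⟩ := h.equiv h'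
      have hf : fib S c (e.symm p) = fib S c' p := by
        ext x
        constructor
        · rintro ⟨hx, hx'⟩
          refine ⟨hx, ?_⟩
          have hx' : c x = e.symm p := hx'
          change c' x = p
          rw [← he x hx, hx', e.apply_symm_apply]
        · rintro ⟨hx, hx'⟩
          refine ⟨hx, ?_⟩
          have hx' : c' x = p := hx'
          change c x = e.symm p
          rw [← hx', ← he x hx, e.symm_apply_apply]
      right
      exact ⟨e.symm p, u, v, hf ▸ hu, hf ▸ hv, hk⟩
  · rintro (⟨κ, h1, h2, h3⟩ | ⟨p, u, v, hu, hv, hk⟩)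
    · exact ⟨_, h3, Or.inr (Or.inr (Or.inl ⟨P, c, h, κ, h1, h2, rfl⟩))⟩
    · exact ⟨_, hk, Or.inr (Or.inr (Or.inr ⟨P, c, h, p, u, v, hu, hv, rfl⟩))⟩

end part5

section part6
open LGraph
set_option linter.unusedSectionVars false

section good
variable {V : Type} [Finite V] {g : LG V} {S A B : Set V} {K K' : KQ}

theorem T_dd : T g.dual.dual S K ↔ T g S K := by rw [LG.dual_dual]

theorem T_cast (h : T g S K) (e : K = K') : T g S K' := e ▸ h

theorem T_set (h : T g A K) (e : A = B) : T g B K := e ▸ h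

theorem kq1 {u v a : KQ} (h : u + v ≤ K) (h' : 0 ≤ u + a) : v ≤ K + a := by
  calc v = 0 + v := (zero_add v).symm
    _ ≤ (u + a) + v := by gcongr
    _ = (u + v) + a := by abel
    _ ≤ K + a := by gcongr

theorem kq2 {u v a : KQ} (h : u + v ≤ K) (h' : 0 ≤ v + a) : u ≤ K + a := by
  rw [add_comm] at h
  exact kq1 h h'

theorem kq3 {k a x : KQ} (h : k ≤ K) (h' : x ≤ k + a) : x ≤ K + a :=
  h'.trans (by gcongr)

theorem kq4 {u v a : KQ} (h : u + v ≤ K) : (u + a) + v ≤ K + a := by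
  calc (u + a) + v = (u + v) + a := by abel
    _ ≤ K + a := by gcongr

theorem kq5 {u v a : KQ} (h : u + v ≤ K) : u + (v + a) ≤ K + a := by
  calc u + (v + a) = (u + v) + a := by abel
    _ ≤ K + a := by gcongr

structure Good {V : Type} [Finite V] (g : LG V) (S : Set V) : Prop where
  d1 : ∀ {A : Set V} {K a : KQ}, Mod g S A → T g S K → T g.dual A a → T g (S \ A) (K + a)
  d2 : ∀ {A : Set V} {K b : KQ}, Mod g S A → T g S K → T g.dual (S \ A) b → T g A (K + b)
  u : ∀ {A : Set V} {u h : KQ}, Mod g S A → T g A u → T g (S \ A) h → T g S (u + h)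
  orth : ∀ {K L : KQ}, T g S K → T g.dual S L → 0 ≤ K + L
  truth : ∀ (Q : LGraph) (J : Set Q.V) (c : V → Q.V) (κ : Q.V → LGraph),
    c '' S = J → (∀ x ∈ S, ∀ y ∈ S, c x ≠ c y → (g.adj x y ↔ Q.adj (c x) (c y))) →
    (∀ q ∈ J, Nonempty (κ q).V) → (∀ q ∈ J, T g (fib S c q) (mk (κ q))) →
    T g S (mk (Q.dual.compOn J κ))

theorem Split.minus {V : Type} {g : LG V} {S A G1 G2 : Set V} (h : Split g S G1 G2)
    (hA : A ⊂ G1) : Split g (S \ A) (G1 \ A) G2 := by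
  refine ⟨?_, h.disj.mono_left Set.sdiff_subset, ?_, h.neB, fun x hx => h.no x hx.1⟩
  · rw [← h.un, Set.union_sdiff_distrib]
    congr 1
    exact (Set.disjoint_left.mpr fun x hx hx' => h.ne (hA.subset hx') hx).sdiff_eq_left.symm
  · exact Set.nonempty_of_ssubset hA

section pres
variable {P : LGraph} {c : V → P.V} {p : P.V}

theorem fib_disj {X : Type} (S : Set V) (c : V → X) {p q : X} (h : p ≠ q) :
    Disjoint (fib S c p) (fib S c q) :=
  Set.disjoint_left.mpr fun _ hx hy => h (hx.2.symm.trans hy.2)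

theorem fib_sub_cofib {X : Type} (S : Set V) (c : V → X) {p q : X} (h : p ≠ q) :
    fib S c p ⊆ S \ fib S c q :=
  fun _ hx => ⟨hx.1, fun hy => h (hx.2.symm.trans hy.2)⟩

theorem fib_cofib {X : Type} (S : Set V) (c : V → X) {p q : X} (h : q ≠ p) :
    fib (S \ fib S c p) c q = fib S c q := by
  ext x
  constructor
  · rintro ⟨⟨h1, _⟩, h2⟩
    exact ⟨h1, h2⟩
  · rintro ⟨h1, h2⟩
    exact ⟨⟨h1, fun h3 => h (h2.symm.trans h3.2)⟩, h2⟩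

theorem Pres.fib_minus (h : A ⊂ fib S c p) : fib (S \ A) c p = fib S c p \ A := by
  ext x
  constructor
  · rintro ⟨⟨h1, h2⟩, h3⟩
    exact ⟨⟨h1, h3⟩, h2⟩
  · rintro ⟨⟨h1, h2⟩, h3⟩
    exact ⟨⟨h1, h3⟩, h2⟩

theorem Pres.fib_minus_ne {j : P.V} (h : A ⊂ fib S c p) (hj : j ≠ p) :
    fib (S \ A) c j = fib S c j := by
  ext x
  constructor
  · rintro ⟨⟨h1, h2⟩, h3⟩
    exact ⟨h1, h3⟩
  · rintro ⟨h1, h3⟩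
    exact ⟨⟨h1, fun hx => hj (h3.symm.trans (h.subset hx).2)⟩, h3⟩

theorem Pres.minus (hP : Pres g S P c) (h : A ⊂ fib S c p) : Pres g (S \ A) P c := by
  refine ⟨hP.prime, hP.card, fun q => ?_, fun x hx y hy => hP.adj x hx.1 y hy.1⟩
  by_cases hq : q = p
  · subst hq
    obtain ⟨x, hx⟩ := Set.nonempty_of_ssubset h
    exact ⟨x, ⟨hx.1.1, hx.2⟩, hx.1.2⟩
  · obtain ⟨x, hx, e⟩ := hP.surj q
    exact ⟨x, ⟨hx, fun hx' => hq (e.symm.trans (h.subset hx').2)⟩, e⟩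

theorem minus1 (h : A ⊂ fib S c p) : (S \ A) \ (fib S c p \ A) = S \ fib S c p := by
  ext x
  have : x ∈ A → x ∈ fib S c p := fun hx => h.subset hx
  simp only [Set.mem_sdiff]
  tauto

theorem sdiff_comm' (S A B : Set V) : (S \ A) \ B = (S \ B) \ A := by
  rw [Set.sdiff_sdiff, Set.sdiff_sdiff, Set.union_comm]

theorem pres_truth (hP : Pres g S P c) (hG : Good g (S \ fib S c p)) {κ : P.V → LGraph}
    (h1 : ∀ q, Nonempty (κ q).V) (h2 : ∀ q, T g (fib S c q) (mk (κ q))) :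
    T g (S \ fib S c p) (mk (P.dual.compOn ({p}ᶜ : Set P.V) κ)) := by
  refine hG.truth P {p}ᶜ c κ ?_ (fun x hx y hy => hP.adj x hx.1 y hy.1) (fun q _ => h1 q) ?_
  · ext q
    constructor
    · rintro ⟨x, hx, rfl⟩ e
      exact hx.2 ⟨hx.1, e⟩
    · intro hq
      obtain ⟨x, hx, rfl⟩ := hP.surj q
      exact ⟨x, ⟨hx, fun h => hq h.2⟩, rfl⟩
  · intro q hq
    rw [fib_cofib S c hq]
    exact h2 q

theorem Pres.modF' (hP : Pres g S P c) {j : P.V} (hj : j ≠ p) :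
    Mod g (S \ fib S c p) (fib S c j) :=
  (hP.mod_fib j).restrict' Set.sdiff_subset (fib_sub_cofib S c hj)

theorem sub_cofib (h : A ⊆ fib S c p) {j : P.V} (hj : j ≠ p) : A ⊆ S \ fib S c j :=
  h.trans (fib_sub_cofib S c hj.symm)

end pres

theorem diff_ssub (hne : A.Nonempty) (hA : A ⊆ S) : S \ A ⊂ S := by
  refine Set.sdiff_subset.ssubset_of_ne fun e => ?_
  obtain ⟨x, hx⟩ := hne
  have : x ∈ S \ A := by rw [e]; exact hA hx
  exact this.2 hx

theorem good_d1 (ih : ∀ S', S' ⊂ S → ∀ g : LG V, Good g S') {a : KQ} (hA : Mod g S A)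
    (hne : A.Nonempty) (hS : A ≠ S) (hK : T g S K) (ha : T g.dual A a) : T g (S \ A) (K + a) := by
  have hss : A ⊂ S := hA.sub.ssubset_of_ne hS
  rcases mod_cases hA hne hS with (h | ⟨G1, G2, h, hG⟩) | (h | ⟨G1, G2, h, hG⟩) | ⟨P, c, p, hP, hF⟩
  · exact h.elim hK ha
  · have hm := hA.restrict' h.subA hG.subset
    refine T_par_intro (h.minus hG) (fun x hx => ?_) (fun x hx => ?_)
    · exact T_cast (h.elim hK ((ih _ h.ssA g.dual).u hm.dual ha hx)) (by abel)
    · exact T_cast ((ih _ h.ssA g).d1 hm (h.swap.elim hK hx) ha) (by abel)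
  · obtain ⟨u, v, hu, hv, hk⟩ := T_join_elim h.join hK
    exact T_le hv (kq1 hk ((ih _ hss g).orth hu ha))
  · have hm := hA.restrict' h.subA hG.subset
    obtain ⟨u, v, hu, hv, hk⟩ := T_join_elim h.join hK
    exact T_le (T_join_intro (h.minus hG).join ((ih _ h.ssA g).d1 hm hu ha) hv) (kq4 hk)
  · rcases hF.eq_or_ssubset with rfl | hF
    · rcases (T_prime hP).mp hK with ⟨κ, h1, h2, hk⟩ | ⟨j, u, v, hu, hv, hk⟩
      · exact T_le (pres_truth hP (ih _ (hP.cofib_ssub p) g) h1 h2)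
          (kq3 hk (C2 P.dual p κ a ((ih _ hss g).orth (h2 p) ha)))
      · by_cases hj : j = p
        · subst hj
          exact T_le hv (kq1 hk ((ih _ hss g).orth hu ha))
        · have t := (ih _ (hP.cofib_ssub j) g).d1 (hP.modF' (Ne.symm hj)) hv ha
          rw [sdiff_comm'] at t
          exact T_le ((ih _ (hP.cofib_ssub p) g).u (hP.modF' hj) hu t) (kq5 hk)
    · have hP' := hP.minus hF
      have hm := hA.restrict' (hP.fib_ssub p).subset hF.subset
      rw [T_prime hP']
      rcases (T_prime hP).mp hK with ⟨κ, h1, h2, hk⟩ | ⟨j, u, v, hu, hv, hk⟩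
      · left
        obtain ⟨X, rfl⟩ := mk_surj a
        classical
        refine ⟨Function.update κ p ((κ p).par X), fun q => ?_, fun q => ?_, ?_⟩
        · by_cases hq : q = p
          · subst hq
            rw [Function.update_self]
            exact ⟨Sum.inl (h1 q).some⟩
          · rw [Function.update_of_ne hq]
            exact h1 q
        · by_cases hq : q = p
          · subst hq
            rw [Function.update_self, Pres.fib_minus hF]
            exact (ih _ (hP.fib_ssub q) g).d1 hm (h2 q) ha
          · rw [Function.update_of_ne hq, Pres.fib_minus_ne hF hq]
            exact h2 q
        · refine kq3 hk (C1 P.dual p κ _ (fun q hq => Function.update_of_ne hq _ _) _ ?_)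
          exact congrArg mk (Function.update_self p _ κ)
      · right
        by_cases hj : j = p
        · subst hj
          refine ⟨j, u + a, v, ?_, ?_, kq4 hk⟩
          · rw [Pres.fib_minus hF]
            exact (ih _ (hP.fib_ssub j) g).d1 hm hu ha
          · rw [Pres.fib_minus hF, minus1 hF]
            exact hv
        · refine ⟨j, u, v + a, ?_, ?_, kq5 hk⟩
          · rw [Pres.fib_minus_ne hF hj]
            exact hu
          · rw [Pres.fib_minus_ne hF hj, sdiff_comm']
            exact (ih _ (hP.cofib_ssub j) g).d1
              (hA.restrict' Set.sdiff_subset (sub_cofib hF.subset hj)) hv ha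

theorem good_u (ih : ∀ S', S' ⊂ S → ∀ g : LG V, Good g S') {u h : KQ} (hA : Mod g S A)
    (hne : A.Nonempty) (hS : A ≠ S) (hu : T g A u) (hh : T g (S \ A) h) : T g S (u + h) := by
  have hss : A ⊂ S := hA.sub.ssubset_of_ne hS
  have hss' : S \ A ⊂ S := diff_ssub hne hA.sub
  rcases mod_cases hA hne hS with (h | ⟨G1, G2, h, hG⟩) | (h | ⟨G1, G2, h, hG⟩) | ⟨P, c, p, hP, hF⟩
  · refine T_par_intro h (fun x hx => ?_) (fun x hx => ?_)
    · exact T_le hh (kq1 le_rfl ((ih _ hss g).orth hu hx))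
    · exact T_le hu (kq2 le_rfl ((ih _ hss' g).orth hh hx))
  · have hm := hA.restrict' h.subA hG.subset
    refine T_par_intro h (fun x hx => ?_) (fun x hx => ?_)
    · have t := (ih _ h.ssA g.dual).d1 hm.dual hx (T_dd.mpr hu)
      exact T_cast ((h.minus hG).elim hh t) (by abel)
    · have t := (h.minus hG).swap.elim hh hx
      exact T_cast ((ih _ h.ssA g).u hm hu t) (by abel)
  · exact T_join_intro h.join hu hh
  · have hm := hA.restrict' h.subA hG.subset
    obtain ⟨h1, h2, t1, t2, hk⟩ := T_join_elim (h.minus hG).join hh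
    refine T_le (T_join_intro h.join ((ih _ h.ssA g).u hm hu t1) t2) ?_
    rw [add_assoc]
    gcongr
  · rcases hF.eq_or_ssubset with rfl | hF
    · rw [T_prime hP]
      exact Or.inr ⟨p, u, h, hu, hh, le_rfl⟩
    · have hP' := hP.minus hF
      have hm := hA.restrict' (hP.fib_ssub p).subset hF.subset
      rw [T_prime hP]
      rcases (T_prime hP').mp hh with ⟨κ, h1, h2, hk⟩ | ⟨j, v, w, hv, hw, hk⟩
      · left
        obtain ⟨X, rfl⟩ := mk_surj u
        classical
        refine ⟨Function.update κ p ((κ p).par X), fun q => ?_, fun q => ?_, ?_⟩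
        · by_cases hq : q = p
          · subst hq
            rw [Function.update_self]
            exact ⟨Sum.inl (h1 q).some⟩
          · rw [Function.update_of_ne hq]
            exact h1 q
        · by_cases hq : q = p
          · subst hq
            rw [Function.update_self]
            have t := h2 q
            rw [Pres.fib_minus hF] at t
            exact T_cast ((ih _ (hP.fib_ssub q) g).u hm hu t) (add_comm _ _)
          · rw [Function.update_of_ne hq, ← Pres.fib_minus_ne hF hq]
            exact h2 q
        · rw [add_comm]
          refine kq3 hk (C1 P.dual p κ _ (fun q hq => Function.update_of_ne hq _ _) _ ?_)
          exact congrArg mk (Function.update_self p _ κ)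
      · right
        by_cases hj : j = p
        · subst hj
          rw [Pres.fib_minus hF] at hv hw
          rw [minus1 hF] at hw
          refine ⟨j, u + v, w, (ih _ (hP.fib_ssub j) g).u hm hu hv, hw, ?_⟩
          rw [add_assoc]
          gcongr
        · rw [Pres.fib_minus_ne hF hj] at hv hw
          rw [sdiff_comm'] at hw
          refine ⟨j, v, u + w, hv, (ih _ (hP.cofib_ssub j) g).u
              (hA.restrict' Set.sdiff_subset (sub_cofib hF.subset hj)) hu hw, ?_⟩
          rw [add_left_comm]
          gcongr

theorem good_d2 (ih : ∀ S', S' ⊂ S → ∀ g : LG V, Good g S') {b : KQ} (hA : Mod g S A)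
    (hne : A.Nonempty) (hS : A ≠ S) (hK : T g S K) (hb : T g.dual (S \ A) b) : T g A (K + b) := by
  have hss : A ⊂ S := hA.sub.ssubset_of_ne hS
  have hss' : S \ A ⊂ S := diff_ssub hne hA.sub
  rcases mod_cases hA hne hS with (h | ⟨G1, G2, h, hG⟩) | (h | ⟨G1, G2, h, hG⟩) | ⟨P, c, p, hP, hF⟩
  · exact h.swap.elim hK hb
  · have hm := hA.restrict' h.subA hG.subset
    obtain ⟨b1, b2, t1, t2, hk⟩ := T_join_elim (h.minus hG).join' hb
    refine T_le ((ih _ h.ssA g).d2 hm (h.swap.elim hK t2) t1) ?_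
    rw [add_assoc, add_comm b2]
    gcongr
  · obtain ⟨u, v, hu, hv, hk⟩ := T_join_elim h.join hK
    exact T_le hu (kq2 hk ((ih _ hss' g).orth hv hb))
  · have hm := hA.restrict' h.subA hG.subset
    obtain ⟨u, v, hu, hv, hk⟩ := T_join_elim h.join hK
    have t := (h.minus hG).swap.elim hb (T_dd.mpr hv)
    refine T_le ((ih _ h.ssA g).d2 hm hu t) ?_
    rw [add_comm b]
    exact kq5 hk
  · rcases hF.eq_or_ssubset with rfl | hF
    · rcases (T_prime hP).mp hK with ⟨κ, h1, h2, hk⟩ | ⟨j, u, v, hu, hv, hk⟩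
      · exact T_le (h2 p) (kq3 hk (C3 P.dual p κ b
          ((ih _ (hP.cofib_ssub p) g).orth (pres_truth hP (ih _ (hP.cofib_ssub p) g) h1 h2) hb)))
      · by_cases hj : j = p
        · subst hj
          exact T_le hu (kq2 hk ((ih _ hss' g).orth hv hb))
        · have t := (ih _ hss' g.dual).d1 (hP.modF' hj).dual hb (T_dd.mpr hu)
          rw [sdiff_comm'] at t
          refine T_le ((ih _ (hP.cofib_ssub j) g).d2 (hP.modF' (Ne.symm hj)) hv t) ?_
          rw [add_comm b, ← add_assoc, add_comm v]
          gcongr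
    · have hP' := hP.minus hF
      have hm := hA.restrict' (hP.fib_ssub p).subset hF.subset
      have hmj : ∀ j, j ≠ p → Mod g (S \ fib S c j) A := fun j hj =>
        hA.restrict' Set.sdiff_subset (sub_cofib hF.subset hj)
      rcases (T_prime hP).mp hK with ⟨κ, h1, h2, hk⟩ | ⟨j, u, v, hu, hv, hk⟩
      · rcases (T_prime hP'.dual).mp hb with ⟨l, l1, l2, hl⟩ | ⟨j, y, z, hy, hz, hl⟩
        · have t := l2 p
          change T g.dual (fib (S \ A) c p) _ at t
          rw [Pres.fib_minus hF] at t
          refine T_le ((ih _ (hP.fib_ssub p) g).d2 hm (h2 p) t) ?_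
          refine (C4 P hP.prime hP.card κ l h1 p fun j hj => ?_).trans ?_
          · have t := l2 j
            change T g.dual (fib (S \ A) c j) _ at t
            rw [Pres.fib_minus_ne hF hj] at t
            exact (ih _ (hP.fib_ssub j) g).orth (h2 j) t
          · have e : P.dual.dual = P := dual_dual P
            refine add_le_add hk (le_trans ?_ hl)
            apply le_of_eq
            apply mk_eq
            exact comp_equiv P P.dual.dual (Equiv.refl _) (fun v w => by
              change P.adj v w ↔ (v ≠ w ∧ ¬ (v ≠ w ∧ ¬ P.adj v w))
              constructor
              · intro h
                exact ⟨fun e => P.irrefl v (by rw [← e] at h; exact h), fun h' => h'.2 h⟩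
              · rintro ⟨h, h'⟩
                by_contra h''
                exact h' ⟨h, h''⟩) l
        · change P.V at j
          change T g.dual (fib (S \ A) c j) _ at hy
          change T g.dual ((S \ A) \ fib (S \ A) c j) _ at hz
          by_cases hj : j = p
          · subst hj
            rw [Pres.fib_minus hF] at hy hz
            rw [minus1 hF] at hz
            have t := (ih _ (hP.fib_ssub j) g).d2 hm (h2 j) hy
            refine T_le t ?_
            have := C3 P.dual j κ z
              ((ih _ (hP.cofib_ssub j) g).orth (pres_truth hP (ih _ (hP.cofib_ssub j) g) h1 h2) hz)
            calc mk (κ j) + y ≤ (mk (P.dual.comp κ) + z) + y := by gcongr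
              _ = mk (P.dual.comp κ) + (y + z) := by abel
              _ ≤ K + b := by gcongr
          · rw [Pres.fib_minus_ne hF hj] at hy hz
            rw [sdiff_comm'] at hz
            have t := (ih _ (hP.cofib_ssub j) g).d2 (hmj j hj)
              (pres_truth hP (ih _ (hP.cofib_ssub j) g) h1 h2) hz
            refine T_le t ?_
            have := C2 P.dual j κ y ((ih _ (hP.fib_ssub j) g).orth (h2 j) hy)
            calc mk (P.dual.compOn ({j}ᶜ : Set P.V) κ) + z ≤ (mk (P.dual.comp κ) + y) + z :=
                  add_le_add_left this z
              _ = mk (P.dual.comp κ) + (y + z) := by abel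
              _ ≤ K + b := by gcongr
      · by_cases hj : j = p
        · subst hj
          have hm' : Mod g.dual (S \ A) (fib S c j \ A) := by
            rw [← Pres.fib_minus hF]
            exact (hP'.mod_fib j).dual
          have t := (ih _ hss' g.dual).d2 hm' hb (by
            rw [minus1 hF]
            exact T_dd.mpr hv)
          refine T_le ((ih _ (hP.fib_ssub j) g).d2 hm hu t) ?_
          rw [add_comm b]
          exact kq5 hk
        · have hm' : Mod g.dual (S \ A) (fib S c j) := by
            rw [← Pres.fib_minus_ne hF hj]
            exact (hP'.mod_fib j).dual
          have t := (ih _ hss' g.dual).d1 hm' hb (T_dd.mpr hu)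
          rw [sdiff_comm'] at t
          refine T_le ((ih _ (hP.cofib_ssub j) g).d2 (hmj j hj) hv t) ?_
          rw [add_comm b, ← add_assoc, add_comm v]
          gcongr

end good
end part6

section part7
open LGraph
set_option linter.unusedSectionVars false

section good2
variable {V : Type} [Finite V] {g : LG V} {S A B : Set V} {K K' : KQ}

theorem mk_comp_dd (P : LGraph) (l : P.V → LGraph) :
    mk (P.comp l) = mk (P.dual.dual.comp l) := by
  apply mk_eq
  exact comp_equiv P P.dual.dual (Equiv.refl _) (fun v w => by
    change P.adj v w ↔ (v ≠ w ∧ ¬ (v ≠ w ∧ ¬ P.adj v w))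
    constructor
    · intro h
      exact ⟨fun e => P.irrefl v (by rw [← e] at h; exact h), fun h' => h'.2 h⟩
    · rintro ⟨h, h'⟩
      by_contra h''
      exact h' ⟨h, h''⟩) l

theorem good_orth (ih : ∀ S', S' ⊂ S → ∀ g : LG V, Good g S') {L : KQ}
    (hK : T g S K) (hL : T g.dual S L) : 0 ≤ K + L := by
  rcases exists_pres g S with rfl | ⟨v, rfl⟩ | ⟨A, B, h⟩ | ⟨A, B, h⟩ | ⟨P, c, hP⟩
  · rw [T_empty] at hK hL
    exact add_nonneg hK hL
  · rw [T_single] at hK hL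
    refine le_trans ?_ (add_le_add hK hL)
    change 0 ≤ mk (single (dualAtom (g.label v))) + mk (single (dualAtom (dualAtom (g.label v))))
    rw [dualAtom_dualAtom]
    exact ai_prov _
  · obtain ⟨x, y, hx, hy, hl⟩ := T_join_elim h.join' hL
    refine ((ih _ h.ssB g).orth (h.elim hK hx) hy).trans ?_
    rw [add_assoc]
    gcongr
  · obtain ⟨x, y, hx, hy, hl⟩ := T_join_elim h.join hK
    refine ((ih _ h.ssB g).orth hy (h.elim hL (T_dd.mpr hx))).trans ?_
    rw [add_comm L, ← add_assoc, add_comm y]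
    gcongr
  · rcases (T_prime hP).mp hK with ⟨κ, h1, h2, hk⟩ | ⟨j, u, v, hu, hv, hk⟩
    · rcases (T_prime hP.dual).mp hL with ⟨l, l1, l2, hl⟩ | ⟨j, y, z, hy, hz, hl⟩
      · have hall : ∀ p : P.V, 0 ≤ mk (κ p) + mk (l p) := fun p =>
          (ih _ (hP.fib_ssub p) g).orth (h2 p) (l2 p)
        obtain ⟨x, hx⟩ := hP.nonempty
        refine (hall (c x)).trans ?_
        refine (C4 P hP.prime hP.card κ l h1 (c x) fun j _ => hall j).trans ?_
        exact add_le_add hk (le_trans (le_of_eq (mk_comp_dd P l)) hl)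
      · change P.V at j
        change T g.dual (fib S c j) _ at hy
        change T g.dual (S \ fib S c j) _ at hz
        have t := good_d1 ih (hP.mod_fib j) (hP.fib_nonempty j) (hP.fib_ne j) hK hy
        refine ((ih _ (hP.cofib_ssub j) g).orth t hz).trans ?_
        rw [add_assoc]
        gcongr
    · have t := good_d1 ih (hP.mod_fib j).dual (hP.fib_nonempty j) (hP.fib_ne j) hL (T_dd.mpr hu)
      refine ((ih _ (hP.cofib_ssub j) g).orth hv t).trans ?_
      rw [add_comm L, ← add_assoc, add_comm v]
      gcongr

/-- The underlying `LG` of a graph. -/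
def LGraph.toLG (Q : LGraph) : LG Q.V := ⟨Q.adj, Q.symm, Q.irrefl, Q.label⟩

theorem truth_sub {Q : LGraph} {J : Set Q.V} {c : V → Q.V} {κ : Q.V → LGraph}
    (h1 : c '' S = J) (h2 : ∀ x ∈ S, ∀ y ∈ S, c x ≠ c y → (g.adj x y ↔ Q.adj (c x) (c y)))
    (h3 : ∀ q ∈ J, Nonempty (κ q).V) (h4 : ∀ q ∈ J, T g (fib S c q) (mk (κ q)))
    {J' : Set Q.V} (hJ : J' ⊆ J) {S' : Set V} (hS' : S' = S ∩ c ⁻¹' J') (hG : Good g S') :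
    T g S' (mk (Q.dual.compOn J' κ)) := by
  refine hG.truth Q J' c κ ?_ ?_ (fun q hq => h3 q (hJ hq)) ?_
  · subst hS' h1
    ext q
    constructor
    · rintro ⟨x, hx, rfl⟩
      exact hx.2
    · intro hq
      obtain ⟨x, hx, rfl⟩ := hJ hq
      exact ⟨x, ⟨hx, hq⟩, rfl⟩
  · subst hS'
    intro x hx y hy
    exact h2 x hx.1 y hy.1
  · intro q hq
    have e : fib S' c q = fib S c q := by
      subst hS'
      ext x
      constructor
      · rintro ⟨⟨h1, _⟩, h2⟩
        exact ⟨h1, h2⟩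
      · rintro ⟨h1, h2⟩
        have h2' : c x = q := h2
        exact ⟨⟨h1, show c x ∈ J' by rw [h2']; exact hq⟩, h2⟩
    rw [e]
    exact h4 q (hJ hq)

theorem good_truth (ih : ∀ S', S' ⊂ S → ∀ g : LG V, Good g S')
    (Q : LGraph) (J : Set Q.V) (c : V → Q.V) (κ : Q.V → LGraph)
    (h1 : c '' S = J) (h2 : ∀ x ∈ S, ∀ y ∈ S, c x ≠ c y → (g.adj x y ↔ Q.adj (c x) (c y)))
    (h3 : ∀ q ∈ J, Nonempty (κ q).V) (h4 : ∀ q ∈ J, T g (fib S c q) (mk (κ q))) :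
    T g S (mk (Q.dual.compOn J κ)) := by
  have hc : ∀ x ∈ S, c x ∈ J := fun x hx => h1 ▸ ⟨x, hx, rfl⟩
  have hs : ∀ q ∈ J, ∃ x ∈ S, c x = q := fun q hq => by
    rw [← h1] at hq
    exact hq
  have hsplit : ∀ J1 J2, J1 ∪ J2 = J → Disjoint J1 J2 → J1.Nonempty → J2.Nonempty →
      (S ∩ c ⁻¹' J1) ∪ (S ∩ c ⁻¹' J2) = S ∧ Disjoint (S ∩ c ⁻¹' J1) (S ∩ c ⁻¹' J2) ∧
      (S ∩ c ⁻¹' J1).Nonempty ∧ (S ∩ c ⁻¹' J2).Nonempty := by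
    intro J1 J2 hu hd hn1 hn2
    refine ⟨?_, ?_, ?_, ?_⟩
    · rw [← Set.inter_union_distrib_left, ← Set.preimage_union, hu]
      exact Set.inter_eq_left.mpr hc
    · exact Set.disjoint_left.mpr fun x hx hy => Set.disjoint_left.mp hd hx.2 hy.2
    · obtain ⟨q, hq⟩ := hn1
      obtain ⟨x, hx, rfl⟩ := hs q (hu ▸ Or.inl hq)
      exact ⟨x, hx, hq⟩
    · obtain ⟨q, hq⟩ := hn2
      obtain ⟨x, hx, rfl⟩ := hs q (hu ▸ Or.inr hq)
      exact ⟨x, hx, hq⟩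
  rcases exists_pres Q.toLG J with hJ | ⟨q, hJ⟩ | ⟨J1, J2, h⟩ | ⟨J1, J2, h⟩ | ⟨P, d, hP⟩
  · have hS : S = ∅ := by
      rw [hJ] at h1
      exact Set.image_eq_empty.mp h1
    rw [T_empty' hS, mk_eq (compOn_empty Q.dual J hJ κ)]
    exact le_of_eq mk_empty.symm
  · have hf : fib S c q = S := by
      refine Set.inter_eq_left.mpr fun x hx => ?_
      have := hc x hx
      rw [hJ] at this
      exact this
    have hq : q ∈ J := by rw [hJ]; exact rfl
    have t := h4 q hq
    rw [hf] at t
    subst hJ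
    exact T_cast t (mk_eq (compOn_single Q.dual q κ))
  · obtain ⟨e1, e2, e3, e4⟩ := hsplit J1 J2 h.un h.disj h.neA h.neB
    have no : ∀ a ∈ J1, ∀ b ∈ J2, ¬ Q.adj a b := h.no
    have hne : ∀ a ∈ J1, ∀ b ∈ J2, a ≠ b := fun a ha b hb e =>
      Set.disjoint_left.mp h.disj ha (e ▸ hb)
    have hS : Split g S (S ∩ c ⁻¹' J1) (S ∩ c ⁻¹' J2) := by
      refine ⟨e1, e2, e3, e4, fun x hx y hy hxy => ?_⟩
      exact no _ hx.2 _ hy.2 ((h2 x hx.1 y hy.1 (hne _ hx.2 _ hy.2)).mp hxy)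
    have t1 := truth_sub h1 h2 h3 h4 h.subA rfl (ih _ hS.ssA g)
    have t2 := truth_sub h1 h2 h3 h4 h.subB rfl (ih _ hS.ssB g)
    refine T_par_intro hS (fun x hx => ?_) (fun x hx => ?_)
    · refine T_le t2 (C5 Q.dual J J1 J2 h.un h.disj κ (fun a ha b hb => ?_) x
        ((ih _ hS.ssA g).orth t1 hx))
      exact ⟨hne a ha b hb, no a ha b hb⟩
    · refine T_le t1 (C5 Q.dual J J2 J1 h.swap.un h.swap.disj κ (fun a ha b hb => ?_) x
        ((ih _ hS.ssB g).orth t2 hx))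
      exact ⟨(hne b hb a ha).symm, fun h' => no b hb a ha (Q.symm h')⟩
  · obtain ⟨e1, e2, e3, e4⟩ := hsplit J1 J2 h.un h.disj h.neA h.neB
    have full : ∀ a ∈ J1, ∀ b ∈ J2, Q.adj a b := h.full
    have hne : ∀ a ∈ J1, ∀ b ∈ J2, a ≠ b := fun a ha b hb e =>
      Set.disjoint_left.mp h.disj ha (e ▸ hb)
    have hS : Split g.dual S (S ∩ c ⁻¹' J1) (S ∩ c ⁻¹' J2) := by
      refine Split.mk_dual e1 e2 e3 e4 fun x hx y hy => ?_
      exact (h2 x hx.1 y hy.1 (hne _ hx.2 _ hy.2)).mpr (full _ hx.2 _ hy.2)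
    have t1 := truth_sub h1 h2 h3 h4 h.subA rfl (ih _ hS.ssA g)
    have t2 := truth_sub h1 h2 h3 h4 h.subB rfl (ih _ hS.ssB g)
    refine T_cast (T_join_intro hS.join t1 t2) ?_
    refine (C6 Q.dual J J1 J2 h.un h.disj κ (fun a ha b hb h' => ?_)).symm
    exact h'.2 (full a ha b hb)
  · have hPS : Pres g S P (fun x => d (c x)) := by
      refine ⟨hP.prime, hP.card, fun p => ?_, fun x hx y hy hxy => ?_⟩
      · obtain ⟨q, hq, rfl⟩ := hP.surj p
        obtain ⟨x, hx, rfl⟩ := hs q hq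
        exact ⟨x, hx, rfl⟩
      · have hne : c x ≠ c y := fun e => hxy (congrArg d e)
        exact (h2 x hx y hy hne).trans (hP.adj _ (hc x hx) _ (hc y hy) hxy)
    have e : ∀ p, fib S (fun x => d (c x)) p = S ∩ c ⁻¹' (J ∩ d ⁻¹' {p}) := by
      intro p
      ext x
      constructor
      · rintro ⟨h1, h2⟩
        exact ⟨h1, hc x h1, h2⟩
      · rintro ⟨h1, _, h2⟩
        exact ⟨h1, h2⟩
    rw [T_prime hPS]
    left
    refine ⟨fun p => Q.dual.compOn (J ∩ d ⁻¹' {p}) κ, fun p => ?_, fun p => ?_, ?_⟩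
    · obtain ⟨q, hq, hp⟩ := hP.surj p
      exact ⟨⟨⟨q, hq, hp⟩, (h3 q hq).some⟩⟩
    · exact truth_sub h1 h2 h3 h4 Set.inter_subset_left (e p) (ih _ (hPS.fib_ssub p) g)
    · apply le_of_eq
      apply mk_eq
      refine compOn_comp Q.dual J κ P.dual d fun x hx y hy hxy => ?_
      have hne : x ≠ y := fun e => hxy (congrArg d e)
      change (x ≠ y ∧ ¬ Q.adj x y) ↔ (d x ≠ d y ∧ ¬ P.adj (d x) (d y))
      exact ⟨fun h => ⟨hxy, fun h' => h.2 ((hP.adj x hx y hy hxy).mpr h')⟩,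
        fun h => ⟨hne, fun h' => h.2 ((hP.adj x hx y hy hxy).mp h')⟩⟩

theorem good (g : LG V) (S : Set V) : Good g S := by
  induction hn : S.ncard using Nat.strong_induction_on generalizing g S with
  | _ n ih0 =>
  have ih : ∀ S', S' ⊂ S → ∀ g : LG V, Good g S' := fun S' hS' g =>
    ih0 _ (hn ▸ ncard_lt hS') g S' rfl
  refine ⟨?_, ?_, ?_, fun hK hL => good_orth ih hK hL, good_truth ih⟩
  · intro A K a hA hK ha
    rcases Set.eq_empty_or_nonempty A with rfl | hne
    · rw [T_empty] at ha
      rw [Set.sdiff_empty]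
      exact T_le hK (le_add_of_nonneg_right ha)
    by_cases hS : A = S
    · subst hS
      rw [Set.sdiff_self, T_empty]
      exact good_orth ih hK ha
    · exact good_d1 ih hA hne hS hK ha
  · intro A K a hA hK ha
    rcases Set.eq_empty_or_nonempty A with rfl | hne
    · rw [Set.sdiff_empty] at ha
      rw [T_empty]
      exact good_orth ih hK ha
    by_cases hS : A = S
    · subst hS
      rw [Set.sdiff_self, T_empty] at ha
      exact T_le hK (le_add_of_nonneg_right ha)
    · exact good_d2 ih hA hne hS hK ha
  · intro A u h hA hu hh
    rcases Set.eq_empty_or_nonempty A with rfl | hne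
    · rw [T_empty] at hu
      rw [Set.sdiff_empty] at hh
      exact T_le hh (le_add_of_nonneg_left hu)
    by_cases hS : A = S
    · subst hS
      rw [Set.sdiff_self, T_empty] at hh
      exact T_le hu (le_add_of_nonneg_right hh)
    · exact good_u ih hA hne hS hu hh

end good2
end part7

section part8
open LGraph
set_option linter.unusedSectionVars false

section mono
variable {V : Type} [Finite V]

theorem T_par_intro' {g : LG V} {S A B : Set V} {K : KQ} (un : A ∪ B = S) (disj : Disjoint A B)
    (no : ∀ x ∈ A, ∀ y ∈ B, ¬ g.adj x y) (h1 : ∀ x, T g.dual A x → T g B (K + x))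
    (h2 : ∀ x, T g.dual B x → T g A (K + x)) : T g S K := by
  rcases Set.eq_empty_or_nonempty A with rfl | hA
  · rw [Set.empty_union] at un
    subst un
    exact T_cast (h1 0 (T_empty.mpr le_rfl)) (add_zero K)
  rcases Set.eq_empty_or_nonempty B with rfl | hB
  · rw [Set.union_empty] at un
    subst un
    exact T_cast (h2 0 (T_empty.mpr le_rfl)) (add_zero K)
  exact T_par_intro ⟨un, disj, hA, hB, no⟩ h1 h2

structure MonoHyp (g : LG V) (C X Y : Set V) : Prop where
  dX : Disjoint C X
  dY : Disjoint C Y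
  unif : ∀ v ∈ C, ∀ x ∈ X ∪ Y, ∀ y ∈ X ∪ Y, (g.adj v x ↔ g.adj v y)
  h1 : ∀ K, T g X K → T g Y K
  h2 : ∀ K, T g.dual Y K → T g.dual X K

theorem MonoHyp.dual {g : LG V} {C X Y : Set V} (h : MonoHyp g C X Y) : MonoHyp g.dual C Y X := by
  refine ⟨h.dY, h.dX, fun v hv x hx y hy => ?_, h.h2, fun K hK => ?_⟩
  · rw [Set.union_comm] at hx hy
    have hne : ∀ z ∈ X ∪ Y, v ≠ z := by
      rintro z (hz | hz) rfl
      · exact Set.disjoint_left.mp h.dX hv hz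
      · exact Set.disjoint_left.mp h.dY hv hz
    exact and_congr (iff_of_true (hne x hx) (hne y hy)) (not_congr (h.unif v hv x hx y hy))
  · exact T_dd.mpr (h.h1 K (T_dd.mp hK))

theorem MonoHyp.mod {g : LG V} {C X Y : Set V} (h : MonoHyp g C X Y) : Mod g (C ∪ X) X := by
  refine ⟨Set.subset_union_right, fun v hv hvX x hx y hy => ?_⟩
  exact h.unif v (hv.resolve_right hvX) x (Or.inl hx) y (Or.inl hy)

theorem MonoHyp.modY {g : LG V} {C X Y : Set V} (h : MonoHyp g C X Y) : Mod g (C ∪ Y) Y := by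
  refine ⟨Set.subset_union_right, fun v hv hvX x hx y hy => ?_⟩
  exact h.unif v (hv.resolve_right hvX) x (Or.inr hx) y (Or.inr hy)

theorem union_diff {C X : Set V} (h : Disjoint C X) : (C ∪ X) \ X = C := by
  rw [Set.union_sdiff_right]
  exact h.sdiff_eq_left

theorem mono_aux (n : ℕ) : ∀ (g : LG V) (C X Y : Set V), C.ncard = n → MonoHyp g C X Y →
    ∀ K, T g (C ∪ X) K → T g (C ∪ Y) K := by
  induction n using Nat.strong_induction_on with
  | _ n ih0 =>
  intro g C X Y hn h K hK
  have ih : ∀ (g : LG V) (C' X Y : Set V), C' ⊂ C → MonoHyp g C' X Y →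
      ∀ K, T g (C' ∪ X) K → T g (C' ∪ Y) K := fun g C' X Y hC =>
    ih0 _ (hn ▸ ncard_lt hC) g C' X Y rfl
  rcases Set.eq_empty_or_nonempty X with rfl | hX
  · rw [Set.union_empty] at hK
    have t : T g Y 0 := h.h1 0 (T_empty.mpr le_rfl)
    refine T_cast ((good g (C ∪ Y)).u h.modY t ?_) (zero_add K)
    rw [union_diff h.dY]
    exact hK
  rcases Set.eq_empty_or_nonempty Y with rfl | hY
  · rw [Set.union_empty]
    have t : T g.dual X 0 := h.h2 0 (T_empty.mpr le_rfl)
    have t' := (good g (C ∪ X)).d1 h.mod hK t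
    rw [union_diff h.dX, add_zero] at t'
    exact t'
  rcases Set.eq_empty_or_nonempty C with rfl | hC
  · rw [Set.empty_union] at hK ⊢
    exact h.h1 K hK
  obtain ⟨x0, hx0⟩ := hX
  obtain ⟨y0, hy0⟩ := hY
  have hXS : X ≠ C ∪ X := by
    intro e
    obtain ⟨v, hv⟩ := hC
    have : v ∈ X := by rw [e]; exact Or.inl hv
    exact Set.disjoint_left.mp h.dX hv this
  -- reducible case
  have red : ∀ G1, Mod g (C ∪ X) G1 → X ⊂ G1 → G1 ≠ C ∪ X → T g (C ∪ Y) K := by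
    intro G1 hm hXG hG
    have s1 : G1 \ X ⊂ C := by
      have hsub : G1 \ X ⊆ C := fun v hv => (hm.sub hv.1).resolve_right hv.2
      refine hsub.ssubset_of_ne fun e => hG ?_
      rw [← e, Set.sdiff_union_of_subset hXG.subset]
    have s2 : C \ G1 ⊂ C := by
      refine Set.sdiff_subset.ssubset_of_ne fun e => ?_
      obtain ⟨v, hv, hv'⟩ := Set.exists_of_ssubset hXG
      have hvC : v ∈ C := (hm.sub hv).resolve_right hv'
      rw [← e] at hvC
      exact hvC.2 hv
    have m1 : MonoHyp g (G1 \ X) X Y :=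
      ⟨h.dX.mono_left s1.subset, h.dY.mono_left s1.subset, fun v hv => h.unif v (s1.subset hv),
        h.h1, h.h2⟩
    have e1 : G1 \ X ∪ X = G1 := Set.sdiff_union_of_subset hXG.subset
    have m2 : MonoHyp g (C \ G1) (G1 \ X ∪ X) (G1 \ X ∪ Y) := by
      refine ⟨?_, ?_, ?_, ih g _ X Y s1 m1, ih g.dual _ Y X s1 m1.dual⟩
      · rw [e1]
        exact Set.disjoint_sdiff_left
      · refine Set.disjoint_left.mpr ?_
        rintro v hv (hv' | hv')
        · exact hv.2 hv'.1
        · exact Set.disjoint_left.mp h.dY hv.1 hv'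
      · intro v hv
        have key : ∀ z ∈ (G1 \ X ∪ X) ∪ (G1 \ X ∪ Y), (g.adj v z ↔ g.adj v x0) := by
          intro z hz
          have hz' : z ∈ G1 ∨ z ∈ Y := by
            rcases hz with hz | hz | hz
            · rw [e1] at hz
              exact Or.inl hz
            · exact Or.inl hz.1
            · exact Or.inr hz
          rcases hz' with hz | hz
          · exact hm.unif v (Or.inl hv.1) hv.2 z hz x0 (hXG.subset hx0)
          · exact h.unif v hv.1 z (Or.inr hz) x0 (Or.inl hx0)
        intro x hx y hy
        exact (key x hx).trans (key y hy).symm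
    have e2 : C \ G1 ∪ (G1 \ X ∪ X) = C ∪ X := by
      rw [e1, Set.sdiff_union_self]
      ext v
      constructor
      · rintro (hv | hv)
        · exact Or.inl hv
        · exact hm.sub hv
      · rintro (hv | hv)
        · exact Or.inl hv
        · exact Or.inr (hXG.subset hv)
    have e3 : C \ G1 ∪ (G1 \ X ∪ Y) = C ∪ Y := by
      ext v
      constructor
      · rintro (hv | hv | hv)
        · exact Or.inl hv.1
        · exact Or.inl (s1.subset hv)
        · exact Or.inr hv
      · rintro (hv | hv)
        · by_cases hv' : v ∈ G1
          · exact Or.inr (Or.inl ⟨hv', Set.disjoint_left.mp h.dX hv⟩)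
          · exact Or.inl ⟨hv, hv'⟩
        · exact Or.inr (Or.inr hv)
    have t := ih g _ _ _ s2 m2 K (by rw [e2]; exact hK)
    rw [e3] at t
    exact t
  rcases mod_cases h.mod ⟨x0, hx0⟩ hXS with (hs | ⟨G1, G2, hs, hG⟩) | (hs | ⟨G1, G2, hs, hG⟩) |
    ⟨P, c, p, hP, hF⟩
  · rw [union_diff h.dX] at hs
    refine T_par_intro' (A := Y) (B := C) (Set.union_comm _ _) h.dY.symm ?_ (fun x hx => ?_)
      (fun x hx => ?_)
    · intro x hx y hy hxy
      have := (h.unif y hy x (Or.inr hx) x0 (Or.inl hx0)).mp (g.symm hxy)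
      exact hs.no x0 hx0 y hy (g.symm this)
    · exact hs.elim hK (h.h2 x hx)
    · exact h.h1 _ (hs.swap.elim hK hx)
  · exact red G1 hs.modA hG hs.ssA.ne
  · rw [union_diff h.dX] at hs
    obtain ⟨u, v, hu, hv, hk⟩ := T_join_elim hs.join hK
    refine T_le (T_join_intro (A := Y) (B := C) ⟨Set.union_comm _ _, h.dY.symm, ?_⟩
      (h.h1 u hu) hv) hk
    intro x hx y hy
    have := hs.full x0 hx0 y hy
    exact g.symm ((h.unif y hy x0 (Or.inl hx0) x (Or.inr hx)).mp (g.symm this))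
  · refine red G1 ?_ hG hs.ssA.ne
    have := hs.modA.dual
    rw [LG.dual_dual] at this
    exact this
  · rcases hF.eq_or_ssubset with hF | hF
    · classical
      let c' : V → P.V := fun v => if v ∈ Y then p else c v
      have cX : ∀ x ∈ X, c x = p := fun x hx => by
        rw [hF] at hx
        exact hx.2
      have cC : ∀ x ∈ C, c x ≠ p := fun x hx e => by
        refine Set.disjoint_left.mp h.dX hx ?_
        rw [hF]
        exact ⟨Or.inl hx, e⟩
      have c'Y : ∀ x ∈ Y, c' x = p := fun x hx => if_pos hx
      have c'C : ∀ x ∈ C, c' x = c x := fun x hx => if_neg (Set.disjoint_left.mp h.dY hx)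
      have mix : ∀ x ∈ Y, ∀ y ∈ C, (g.adj y x ↔ P.adj (c y) p) := by
        intro x hx y hy
        refine (h.unif y hy x (Or.inr hx) x0 (Or.inl hx0)).trans ?_
        have := hP.adj y (Or.inl hy) x0 (Or.inr hx0) (by rw [cX x0 hx0]; exact cC y hy)
        rwa [cX x0 hx0] at this
      have hP' : Pres g (C ∪ Y) P c' := by
        refine ⟨hP.prime, hP.card, fun q => ?_, ?_⟩
        · by_cases hq : q = p
          · exact ⟨y0, Or.inr hy0, (c'Y y0 hy0).trans hq.symm⟩
          · obtain ⟨x, hx | hx, e⟩ := hP.surj q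
            · exact ⟨x, Or.inl hx, (c'C x hx).trans e⟩
            · exact (hq (e.symm.trans (cX x hx))).elim
        · rintro x (hx | hx) y (hy | hy) hxy
          · rw [c'C x hx, c'C y hy] at hxy ⊢
            exact hP.adj x (Or.inl hx) y (Or.inl hy) hxy
          · rw [c'C x hx, c'Y y hy]
            exact mix y hy x hx
          · rw [c'C y hy, c'Y x hx]
            exact ⟨fun t => P.symm ((mix x hx y hy).mp (g.symm t)),
              fun t => g.symm ((mix x hx y hy).mpr (P.symm t))⟩
          · exact (hxy ((c'Y x hx).trans (c'Y y hy).symm)).elim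
      have fp : fib (C ∪ Y) c' p = Y := by
        ext v
        constructor
        · rintro ⟨hv | hv, e⟩
          · exact (cC v hv ((c'C v hv).symm.trans e)).elim
          · exact hv
        · intro hv
          exact ⟨Or.inr hv, c'Y v hv⟩
      have fX : ∀ q, q ≠ p → fib (C ∪ X) c q ⊆ C := by
        rintro q hq v ⟨hv | hv, e⟩
        · exact hv
        · exact (hq (e.symm.trans (cX v hv))).elim
      have fq : ∀ q, q ≠ p → fib (C ∪ Y) c' q = fib (C ∪ X) c q := by
        intro q hq
        ext v
        constructor
        · rintro ⟨hv | hv, e⟩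
          · exact ⟨Or.inl hv, (c'C v hv).symm.trans e⟩
          · exact (hq (e.symm.trans (c'Y v hv))).elim
        · intro hv
          have hv' := fX q hq hv
          exact ⟨Or.inl hv', (c'C v hv').trans hv.2⟩
      rw [T_prime hP']
      rcases (T_prime hP).mp hK with ⟨κ, h1, h2, hk⟩ | ⟨j, u, v, hu, hv, hk⟩
      · left
        refine ⟨κ, h1, fun q => ?_, hk⟩
        by_cases hq : q = p
        · subst hq
          rw [fp]
          have := h2 q
          rw [← hF] at this
          exact h.h1 _ this
        · rw [fq q hq]
          exact h2 q
      · right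
        by_cases hj : j = p
        · subst hj
          rw [← hF] at hu hv
          rw [union_diff h.dX] at hv
          refine ⟨j, u, v, ?_, ?_, hk⟩
          · rw [fp]
            exact h.h1 u hu
          · rw [fp, union_diff h.dY]
            exact hv
        · refine ⟨j, u, v, ?_, ?_, hk⟩
          · rw [fq j hj]
            exact hu
          · rw [fq j hj]
            have hsub := fX j hj
            have s1 : C \ fib (C ∪ X) c j ⊂ C := diff_ssub (hP.fib_nonempty j) hsub
            have ed : ∀ Z, Disjoint C Z →
                (C ∪ Z) \ fib (C ∪ X) c j = (C \ fib (C ∪ X) c j) ∪ Z := by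
              intro Z hZ
              rw [Set.union_sdiff_distrib]
              congr 1
              exact (hZ.mono_left hsub).symm.sdiff_eq_left
            rw [ed X h.dX] at hv
            rw [ed Y h.dY]
            exact ih g _ X Y s1 ⟨h.dX.mono_left s1.subset, h.dY.mono_left s1.subset,
              fun v hv => h.unif v (s1.subset hv), h.h1, h.h2⟩ v hv
    · exact red _ (hP.mod_fib p) hF (hP.fib_ne p)

theorem mono {g : LG V} {C X Y : Set V} (h : MonoHyp g C X Y) {K : KQ} (hK : T g (C ∪ X) K) :
    T g (C ∪ Y) K := mono_aux _ g C X Y rfl h K hK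

end mono

section emb
variable {V W : Type} [Finite V] [Finite W]

/-- Embeddings of labelled graphs. -/
structure Emb (g : LG V) (g' : LG W) (f : V → W) : Prop where
  inj : Function.Injective f
  adj : ∀ x y, g.adj x y ↔ g'.adj (f x) (f y)
  label : ∀ x, g'.label (f x) = g.label x

theorem Emb.dual {g : LG V} {g' : LG W} {f : V → W} (h : Emb g g' f) : Emb g.dual g'.dual f := by
  refine ⟨h.inj, fun x y => ?_, fun x => congrArg dualAtom (h.label x)⟩
  exact and_congr h.inj.ne_iff.symm (not_congr (h.adj x y))

theorem Emb.split {g : LG V} {g' : LG W} {f : V → W} (h : Emb g g' f) {S A B : Set V}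
    (hs : Split g S A B) : Split g' (f '' S) (f '' A) (f '' B) := by
  refine ⟨?_, ?_, hs.neA.image f, hs.neB.image f, ?_⟩
  · rw [← Set.image_union, hs.un]
  · exact (Set.disjoint_image_iff h.inj).mpr hs.disj
  · rintro _ ⟨x, hx, rfl⟩ _ ⟨y, hy, rfl⟩ hxy
    exact hs.no x hx y hy ((h.adj x y).mpr hxy)

theorem T_par_iff {g : LG V} {S A B : Set V} (h : Split g S A B) {K : KQ} : T g S K ↔
    (∀ x, T g.dual A x → T g B (K + x)) ∧ (∀ x, T g.dual B x → T g A (K + x)) :=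
  ⟨fun hK => ⟨fun _ hx => h.elim hK hx, fun _ hx => h.swap.elim hK hx⟩,
    fun hK => T_par_intro h hK.1 hK.2⟩

theorem T_join_iff {g : LG V} {S A B : Set V} (h : Join g S A B) {K : KQ} : T g S K ↔
    ∃ u v, T g A u ∧ T g B v ∧ u + v ≤ K :=
  ⟨T_join_elim h, fun ⟨_, _, hu, hv, hk⟩ => T_le (T_join_intro h hu hv) hk⟩

theorem T_emb_aux {f : V → W} (n : ℕ) : ∀ (g : LG V) (g' : LG W) (S : Set V) (K : KQ),
    S.ncard = n → Emb g g' f → (T g S K ↔ T g' (f '' S) K) := by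
  induction n using Nat.strong_induction_on with
  | _ n ih0 =>
  intro g g' S K hn h
  have ih : ∀ S', S' ⊂ S → ∀ {K}, T g S' K ↔ T g' (f '' S') K := fun S' hS {K} =>
    ih0 _ (hn ▸ ncard_lt hS) g g' S' K rfl h
  have ihd : ∀ S', S' ⊂ S → ∀ {K}, T g.dual S' K ↔ T g'.dual (f '' S') K := fun S' hS {K} =>
    ih0 _ (hn ▸ ncard_lt hS) g.dual g'.dual S' K rfl h.dual
  rcases exists_pres g S with rfl | ⟨v, rfl⟩ | ⟨A, B, hs⟩ | ⟨A, B, hs⟩ | ⟨P, c, hP⟩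
  · rw [Set.image_empty, T_empty, T_empty]
  · rw [Set.image_singleton, T_single, T_single, h.label]
  · rw [T_par_iff hs, T_par_iff (h.split hs)]
    refine and_congr (forall_congr' fun x => ?_) (forall_congr' fun x => ?_)
    · rw [ihd _ hs.ssA, ih _ hs.ssB]
    · rw [ihd _ hs.ssB, ih _ hs.ssA]
  · rw [T_join_iff hs.join, T_join_iff (h.dual.split hs).join]
    refine exists_congr fun u => exists_congr fun v => ?_
    rw [ih _ hs.ssA, ih _ hs.ssB]
  · obtain ⟨x0, hx0⟩ := hP.nonempty
    let c' : W → P.V := Function.extend f c fun _ => c x0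
    have hc : ∀ x, c' (f x) = c x := fun x => h.inj.extend_apply _ _ _
    have hP' : Pres g' (f '' S) P c' := by
      refine ⟨hP.prime, hP.card, fun q => ?_, ?_⟩
      · obtain ⟨x, hx, rfl⟩ := hP.surj q
        exact ⟨f x, ⟨x, hx, rfl⟩, hc x⟩
      · rintro _ ⟨x, hx, rfl⟩ _ ⟨y, hy, rfl⟩ hxy
        rw [hc, hc] at hxy ⊢
        exact (h.adj x y).symm.trans (hP.adj x hx y hy hxy)
    have hf : ∀ p, fib (f '' S) c' p = f '' fib S c p := by
      intro p
      ext w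
      constructor
      · rintro ⟨⟨x, hx, rfl⟩, e⟩
        exact ⟨x, ⟨hx, (hc x).symm.trans e⟩, rfl⟩
      · rintro ⟨x, ⟨hx, e⟩, rfl⟩
        exact ⟨⟨x, hx, rfl⟩, (hc x).trans e⟩
    rw [T_prime hP, T_prime hP']
    refine or_congr ?_ ?_
    · refine exists_congr fun κ => and_congr_right fun _ => and_congr_left fun _ =>
        forall_congr' fun p => ?_
      rw [hf, ih _ (hP.fib_ssub p)]
    · refine exists_congr fun p => exists_congr fun u => exists_congr fun v => ?_
      rw [hf, ih _ (hP.fib_ssub p), ← Set.image_sdiff h.inj, ih _ (hP.cofib_ssub p)]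

theorem T_emb {f : V → W} {g : LG V} {g' : LG W} (h : Emb g g' f) {S : Set V} {K : KQ} :
    T g S K ↔ T g' (f '' S) K := T_emb_aux _ g g' S K rfl h

theorem T_emb_univ {f : V → W} {g : LG V} {g' : LG W} (h : Emb g g' f) {S : Set W}
    (hS : S = Set.range f) {K : KQ} : T g Set.univ K ↔ T g' S K := by
  rw [T_emb h, Set.image_univ, hS]

end emb
end part8

section part9
open LGraph
set_option linter.unusedSectionVars false

section final

def TT (X : LGraph) (K : KQ) : Prop := T X.toLG Set.univ K

theorem TT_dual (X : LGraph) (K : KQ) : TT X.dual K ↔ T X.toLG.dual Set.univ K := Iff.rfl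

/-- Semantic entailment. -/
structure Le (X Y : LGraph) : Prop where
  pos : ∀ K, TT X K → TT Y K
  neg : ∀ K, TT Y.dual K → TT X.dual K

theorem Le.refl (X : LGraph) : Le X X := ⟨fun _ h => h, fun _ h => h⟩

theorem Le.trans {X Y Z : LGraph} (h1 : Le X Y) (h2 : Le Y Z) : Le X Z :=
  ⟨fun K h => h2.pos K (h1.pos K h), fun K h => h1.neg K (h2.neg K h)⟩

theorem Le.dual {X Y : LGraph} (h : Le X Y) : Le Y.dual X.dual :=
  ⟨h.neg, fun K hK => by
    rw [dual_dual] at hK ⊢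
    exact h.pos K hK⟩

theorem Le.of_dual {X Y : LGraph} (h : Le Y.dual X.dual) : Le X Y := by
  have := h.dual
  rwa [dual_dual, dual_dual] at this

theorem Le.ofIso {X Y : LGraph} (h : X.iso Y) : Le X Y := by
  obtain ⟨e⟩ := h
  have he : Emb X.toLG Y.toLG e.toEquiv :=
    ⟨e.toEquiv.injective, e.adj_iff, e.label_eq⟩
  have hr : Set.univ = Set.range e.toEquiv := e.toEquiv.surjective.range_eq.symm
  exact ⟨fun K h => (T_emb_univ he hr).mp h,
    fun K h => (T_emb_univ he.dual hr).mpr h⟩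

theorem embL (C : LGraph) (R : Set C.V) (X : LGraph) :
    Emb C.toLG (C.plug R X).toLG (Sum.inl : C.V → C.V ⊕ X.V) :=
  ⟨Sum.inl_injective, fun _ _ => Iff.rfl, fun _ => rfl⟩

theorem embR (C : LGraph) (R : Set C.V) (X : LGraph) :
    Emb X.toLG (C.plug R X).toLG (Sum.inr : X.V → C.V ⊕ X.V) :=
  ⟨Sum.inr_injective, fun _ _ => Iff.rfl, fun _ => rfl⟩

theorem Emb.comp {U V W : Type} [Finite U] [Finite V] [Finite W] {g : LG U} {g' : LG V} {g'' : LG W}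
    {f : U → V} {f' : V → W} (h' : Emb g' g'' f') (h : Emb g g' f) : Emb g g'' (f' ∘ f) :=
  ⟨h'.inj.comp h.inj, fun x y => (h.adj x y).trans (h'.adj _ _),
    fun x => (h'.label _).trans (h.label x)⟩

theorem Le.plug (C : LGraph) (R : Set C.V) {X Y : LGraph} (h : Le X Y) :
    Le (C.plug R X) (C.plug R Y) := by
  let D := C.plug R (X.par Y)
  let fC : C.V → D.V := (Sum.inl : C.V → C.V ⊕ (X.V ⊕ Y.V))
  let fX : X.V → D.V := fun x => (Sum.inr (Sum.inl x) : C.V ⊕ (X.V ⊕ Y.V))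
  let fY : Y.V → D.V := fun x => (Sum.inr (Sum.inr x) : C.V ⊕ (X.V ⊕ Y.V))
  have eX : Emb X.toLG D.toLG fX :=
    ⟨Sum.inr_injective.comp Sum.inl_injective, fun _ _ => Iff.rfl, fun _ => rfl⟩
  have eY : Emb Y.toLG D.toLG fY :=
    ⟨Sum.inr_injective.comp Sum.inr_injective, fun _ _ => Iff.rfl, fun _ => rfl⟩
  let gX : (C.plug R X).V → D.V := (Sum.map id Sum.inl : C.V ⊕ X.V → C.V ⊕ (X.V ⊕ Y.V))
  let gY : (C.plug R Y).V → D.V := (Sum.map id Sum.inr : C.V ⊕ Y.V → C.V ⊕ (X.V ⊕ Y.V))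
  have hX : Emb (C.plug R X).toLG D.toLG gX := by
    refine ⟨Function.Injective.sumMap Function.injective_id Sum.inl_injective, ?_, ?_⟩
    · rintro (x | x) (y | y) <;> exact Iff.rfl
    · rintro (x | x) <;> rfl
  have hY : Emb (C.plug R Y).toLG D.toLG gY := by
    refine ⟨Function.Injective.sumMap Function.injective_id Sum.inr_injective, ?_, ?_⟩
    · rintro (x | x) (y | y) <;> exact Iff.rfl
    · rintro (x | x) <;> rfl
  have rX : Set.range fC ∪ Set.range fX = Set.range gX := by
    ext d
    constructor
    · rintro (⟨x, rfl⟩ | ⟨x, rfl⟩)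
      · exact ⟨Sum.inl x, rfl⟩
      · exact ⟨Sum.inr x, rfl⟩
    · rintro ⟨x | x, rfl⟩
      · exact Or.inl ⟨x, rfl⟩
      · exact Or.inr ⟨x, rfl⟩
  have rY : Set.range fC ∪ Set.range fY = Set.range gY := by
    ext d
    constructor
    · rintro (⟨x, rfl⟩ | ⟨x, rfl⟩)
      · exact ⟨Sum.inl x, rfl⟩
      · exact ⟨Sum.inr x, rfl⟩
    · rintro ⟨x | x, rfl⟩
      · exact Or.inl ⟨x, rfl⟩
      · exact Or.inr ⟨x, rfl⟩
  have hm : MonoHyp D.toLG (Set.range fC) (Set.range fX) (Set.range fY) := by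
    refine ⟨?_, ?_, ?_, fun K hK => ?_, fun K hK => ?_⟩
    · refine Set.disjoint_left.mpr ?_
      rintro _ ⟨x, rfl⟩ ⟨y, e⟩
      exact Sum.inr_ne_inl e
    · refine Set.disjoint_left.mpr ?_
      rintro _ ⟨x, rfl⟩ ⟨y, e⟩
      exact Sum.inr_ne_inl e
    · rintro _ ⟨v, rfl⟩ _ (⟨x, rfl⟩ | ⟨x, rfl⟩) _ (⟨y, rfl⟩ | ⟨y, rfl⟩) <;> exact Iff.rfl
    · exact (T_emb_univ eY rfl).mp (h.pos K ((T_emb_univ eX rfl).mpr hK))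
    · exact (T_emb_univ eX.dual rfl).mp (h.neg K ((T_emb_univ eY.dual rfl).mpr hK))
  exact ⟨fun K hK => (T_emb_univ hY rY).mpr (mono hm ((T_emb_univ hX rX).mp hK)),
    fun K hK => (T_emb_univ hX.dual rX).mpr (mono hm.dual ((T_emb_univ hY.dual rY).mp hK))⟩

theorem range_union (X Y : Type) :
    Set.range (Sum.inl : X → X ⊕ Y) ∪ Set.range (Sum.inr : Y → X ⊕ Y) = Set.univ :=
  Set.range_inl_union_range_inr

theorem range_disj (X Y : Type) :
    Disjoint (Set.range (Sum.inl : X → X ⊕ Y)) (Set.range (Sum.inr : Y → X ⊕ Y)) :=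
  Set.isCompl_range_inl_range_inr.disjoint

/-- `ss↓` -/
theorem Le.ss (B A : LGraph) (S : Set B.V) : Le (B.plug S A) (B.par A) := by
  have l1 := embL B S A
  have r1 := embR B S A
  have l2 : Emb B.toLG (B.par A).toLG (Sum.inl : B.V → B.V ⊕ A.V) :=
    ⟨Sum.inl_injective, fun _ _ => Iff.rfl, fun _ => rfl⟩
  have r2 : Emb A.toLG (B.par A).toLG (Sum.inr : A.V → B.V ⊕ A.V) :=
    ⟨Sum.inr_injective, fun _ _ => Iff.rfl, fun _ => rfl⟩
  have un := range_union B.V A.V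
  have dj := range_disj B.V A.V
  have hm : Mod (B.plug S A).toLG Set.univ (Set.range (Sum.inr : A.V → B.V ⊕ A.V)) := by
    refine ⟨fun _ _ => trivial, ?_⟩
    rintro (v | v) _ hv _ ⟨x, rfl⟩ _ ⟨y, rfl⟩
    · exact Iff.rfl
    · exact (hv ⟨v, rfl⟩).elim
  have ed : (Set.univ : Set (B.V ⊕ A.V)) \ Set.range (Sum.inr : A.V → B.V ⊕ A.V) =
      Set.range (Sum.inl : B.V → B.V ⊕ A.V) := by
    rw [← un]
    exact union_diff dj
  have no : ∀ x ∈ Set.range (Sum.inl : B.V → B.V ⊕ A.V),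
      ∀ y ∈ Set.range (Sum.inr : A.V → B.V ⊕ A.V), ¬ (B.par A).toLG.adj x y := by
    rintro _ ⟨x, rfl⟩ _ ⟨y, rfl⟩ h
    exact h
  constructor
  · intro K hK
    refine T_par_intro' (g := (B.par A).toLG) un dj no (fun x hx => ?_) (fun x hx => ?_)
    · refine (T_emb_univ r2 rfl).mp ((T_emb_univ r1 rfl).mpr ?_)
      refine (good (B.plug S A).toLG Set.univ).d2 hm hK ?_
      have := (T_emb_univ l1.dual rfl).mp ((T_emb_univ l2.dual rfl).mpr hx)
      exact T_set this ed.symm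
    · refine (T_emb_univ l2 rfl).mp ((T_emb_univ l1 rfl).mpr ?_)
      refine T_set ((good (B.plug S A).toLG Set.univ).d1 hm hK ?_) ed
      exact (T_emb_univ r1.dual rfl).mp ((T_emb_univ r2.dual rfl).mpr hx)
  · intro K hK
    have hj : Join (B.par A).toLG.dual Set.univ (Set.range (Sum.inl : B.V → B.V ⊕ A.V))
        (Set.range (Sum.inr : A.V → B.V ⊕ A.V)) :=
      ⟨un, dj, fun x hx y hy => ⟨fun e => Set.disjoint_left.mp dj hx (e ▸ hy), no x hx y hy⟩⟩
    obtain ⟨u, v, hu, hv, hk⟩ := T_join_elim hj hK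
    have hu' := (T_emb_univ l1.dual rfl).mp ((T_emb_univ l2.dual rfl).mpr hu)
    have hv' := (T_emb_univ r1.dual rfl).mp ((T_emb_univ r2.dual rfl).mpr hv)
    have t := (good (B.plug S A).toLG.dual Set.univ).u hm.dual hv' (T_set hu' ed.symm)
    refine T_le t ?_
    rw [add_comm]
    exact hk

theorem Le.ax (X : LGraph) : Le LGraph.empty (X.dual.par X) := by
  have l : Emb X.toLG.dual (X.dual.par X).toLG (Sum.inl : X.V → X.V ⊕ X.V) :=
    ⟨Sum.inl_injective, fun _ _ => Iff.rfl, fun _ => rfl⟩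
  have r : Emb X.toLG (X.dual.par X).toLG (Sum.inr : X.V → X.V ⊕ X.V) :=
    ⟨Sum.inr_injective, fun _ _ => Iff.rfl, fun _ => rfl⟩
  have un := range_union X.V X.V
  have dj := range_disj X.V X.V
  have no : ∀ x ∈ Set.range (Sum.inl : X.V → X.V ⊕ X.V),
      ∀ y ∈ Set.range (Sum.inr : X.V → X.V ⊕ X.V), ¬ (X.dual.par X).toLG.adj x y := by
    rintro _ ⟨x, rfl⟩ _ ⟨y, rfl⟩ h
    exact h
  have he : (Set.univ : Set LGraph.empty.V) = ∅ := by
    ext x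
    exact Empty.elim x
  constructor
  · intro K hK
    have hK : 0 ≤ K := (T_empty' he).mp hK
    refine T_par_intro' (g := (X.dual.par X).toLG) un dj no (fun x hx => ?_) (fun x hx => ?_)
    · have := T_dd.mp ((T_emb_univ l.dual rfl).mpr hx)
      exact T_le ((T_emb_univ r rfl).mp this) (le_add_of_nonneg_left hK)
    · have := (T_emb_univ r.dual rfl).mpr hx
      exact T_le ((T_emb_univ l rfl).mp this) (le_add_of_nonneg_left hK)
  · intro K hK
    have hj : Join (X.dual.par X).toLG.dual Set.univ (Set.range (Sum.inl : X.V → X.V ⊕ X.V))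
        (Set.range (Sum.inr : X.V → X.V ⊕ X.V)) :=
      ⟨un, dj, fun x hx y hy => ⟨fun e => Set.disjoint_left.mp dj hx (e ▸ hy), no x hx y hy⟩⟩
    obtain ⟨u, v, hu, hv, hk⟩ := T_join_elim hj hK
    have hu' := T_dd.mp ((T_emb_univ l.dual rfl).mpr hu)
    have hv' := (T_emb_univ r.dual rfl).mpr hv
    exact (T_empty' (S := (Set.univ : Set LGraph.empty.V)) he).mpr
      (((good X.toLG Set.univ).orth hu' hv').trans hk)

end final
end part9

section part10
open LGraph

section final2

theorem Le.ssUp (B A : LGraph) (S : Set B.V) : Le (B.tensor A) (B.plug S A) := by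
  apply Le.of_dual
  rw [plug_dual, tensor_dual]
  exact Le.ss B.dual A.dual _

theorem Le.cut (X : LGraph) : Le (X.tensor X.dual) LGraph.empty := by
  apply Le.of_dual
  rw [tensor_dual]
  have h : Le LGraph.empty.dual LGraph.empty :=
    Le.ofIso (iso_empty _ (show IsEmpty Empty from inferInstance))
  exact h.trans ((Le.ax X.dual).trans (Le.ofIso (par_comm _ _)))

theorem Le.tensorR (A : LGraph) {X Y : LGraph} (h : Le X Y) : Le (A.tensor X) (A.tensor Y) := by
  rw [tensor_eq_plug, tensor_eq_plug]
  exact Le.plug A _ h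

theorem Le.parR (A : LGraph) {X Y : LGraph} (h : Le X Y) : Le (A.par X) (A.par Y) := by
  rw [par_eq_plug, par_eq_plug]
  exact Le.plug A _ h

theorem Le.str (F C : LGraph) (R : Set C.V) (Y : LGraph) :
    Le (F.tensor (C.plug R Y)) (C.plug R (F.tensor Y)) := by
  refine (Le.ofIso (tensor_comm _ _)).trans ?_
  refine (Le.ssUp (C.plug R Y) F {x | Sum.elim (fun x => x ∈ R) (fun _ => True) x}).trans ?_
  refine (Le.ofIso (iso_symm (plug_tensor C R Y F))).trans ?_
  exact Le.ofIso (plug_congr C R (tensor_comm _ _))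

theorem Le.bigTensor (P : LGraph) (n : ℕ) : ∀ (F : Fin n → LGraph) (f : Fin n → P.V),
    Function.Injective f → ∀ (Y Y' : P.V → LGraph),
    (∀ i, Le ((F i).tensor (Y (f i))) (Y' (f i))) → (∀ q, (∀ i, f i ≠ q) → Y' q = Y q) →
    Le ((bigTensor n F).tensor (P.comp Y)) (P.comp Y') := by
  induction n with
  | zero =>
    intro F f hf Y Y' h1 h2
    have e : Y' = Y := funext fun q => h2 q fun i => i.elim0
    rw [e, tensor_eq_plug]
    exact Le.ofIso (iso_symm (isEmpty_plug _ _ _ (show IsEmpty Empty from inferInstance)))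
  | succ n ih =>
    intro F f hf Y Y' h1 h2
    classical
    let Y1 := Function.update Y (f 0) (Y' (f 0))
    have a1 : Le ((F 0).tensor (P.comp Y)) (P.comp Y1) := by
      refine (Le.tensorR _ (Le.ofIso (comp_iso_plug P (f 0) Y))).trans ?_
      refine (Le.str _ _ _ _).trans ?_
      refine (Le.plug _ _ (h1 0)).trans ?_
      have := comp_iso_plug' P (f 0) Y Y1 fun q hq => Function.update_of_ne hq _ _
      rw [show Y1 (f 0) = Y' (f 0) from Function.update_self _ _ _] at this
      exact Le.ofIso (iso_symm this)
    have a2 := ih (fun i => F i.succ) (fun i => f i.succ)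
      (fun i j hij => Fin.succ_injective _ (hf hij)) Y1 Y' ?_ ?_
    · change Le (((F 0).tensor (GSP.bigTensor n fun i => F i.succ)).tensor (P.comp Y)) _
      refine Le.trans ?_ a2
      have b1 : Le (((F 0).tensor (GSP.bigTensor n fun i => F i.succ)).tensor (P.comp Y))
          (((GSP.bigTensor n fun i => F i.succ).tensor (F 0)).tensor (P.comp Y)) := by
        refine (Le.ofIso (tensor_comm _ _)).trans ?_
        refine (Le.tensorR _ (Le.ofIso (tensor_comm _ _))).trans ?_
        exact Le.ofIso (tensor_comm _ _)
      refine b1.trans ((Le.ofIso (tensor_assoc _ _ _)).trans ?_)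
      exact Le.tensorR _ a1
    · intro i
      have hne : f i.succ ≠ f 0 := fun e => Fin.succ_ne_zero i (hf e)
      rw [show Y1 (f i.succ) = Y (f i.succ) from Function.update_of_ne hne _ _]
      exact h1 i.succ
    · intro q hq
      by_cases hq0 : q = f 0
      · subst hq0
        exact (show Y1 (f 0) = Y' (f 0) from Function.update_self _ _ _).symm
      · rw [show Y1 q = Y q from Function.update_of_ne hq0 _ _]
        refine h2 q fun i => ?_
        refine Fin.cases ?_ (fun i => hq i) i
        exact fun e => hq0 e.symm

theorem Le.pDown (n : ℕ) (P : LGraph) (e : P.V ≃ Fin n) (M N : Fin n → LGraph) :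
    Le (GSP.bigTensor n fun i => (M i).par (N i))
      ((P.dual.comp fun v => M (e v)).par (P.comp fun v => N (e v))) := by
  set X := GSP.bigTensor n fun i => (M i).par (N i) with hX
  let Q := P.comp fun v => (M (e v)).dual
  have hQ : Q.dual = P.dual.comp fun v => M (e v) := by
    refine (comp_dual P _).trans ?_
    congr 1
    funext v
    exact dual_dual _
  have hR : Le (X.tensor Q) (P.comp fun v => N (e v)) := by
    refine Le.bigTensor P n _ e.symm e.symm.injective _ _ (fun i => ?_) (fun q hq => ?_)
    · rw [e.apply_symm_apply]
      refine (Le.ofIso (tensor_comm _ _)).trans ?_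
      have h1 : Le ((M i).par (N i)) ((N i).plug ∅ (M i)) := by
        rw [← par_eq_plug]
        exact Le.ofIso (par_comm _ _)
      refine (Le.tensorR _ h1).trans ((Le.str _ _ _ _).trans ?_)
      refine (Le.plug _ _ ((Le.ofIso (tensor_comm _ _)).trans (Le.cut (M i)))).trans ?_
      exact Le.ofIso (iso_symm (plug_isEmpty _ _ _ (show IsEmpty Empty from inferInstance)))
    · exact (hq (e q) (e.symm_apply_apply q)).elim
  have s1 : Le X (X.tensor LGraph.empty) := by
    rw [tensor_eq_plug]
    exact Le.ofIso (plug_isEmpty _ _ _ (show IsEmpty Empty from inferInstance))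
  have s2 : Le X (X.tensor (Q.dual.par Q)) := s1.trans (Le.tensorR X (Le.ax Q))
  have s3 : Le (X.tensor (Q.dual.par Q)) (Q.dual.par (X.tensor Q)) := by
    rw [par_eq_plug, par_eq_plug]
    exact Le.str _ _ _ _
  have := s2.trans (s3.trans (Le.parR Q.dual hR))
  rw [hQ] at this
  exact this

theorem bigPar_dual (n : ℕ) : ∀ F : Fin n → LGraph,
    ((bigPar n F).dual).iso (GSP.bigTensor n fun i => (F i).dual) := by
  induction n with
  | zero =>
    intro F
    exact iso_empty _ (show IsEmpty Empty from inferInstance)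
  | succ n ih =>
    intro F
    change (((F 0).par (bigPar n fun i => F i.succ)).dual).iso
      ((F 0).dual.tensor (GSP.bigTensor n fun i => (F i.succ).dual))
    rw [par_dual, tensor_eq_plug, tensor_eq_plug]
    exact plug_congr _ _ (ih _)

theorem Le.pUp (n : ℕ) (P : LGraph) (e : P.V ≃ Fin n) (M N : Fin n → LGraph) :
    Le ((P.comp fun v => M (e v)).tensor (P.dual.comp fun v => N (e v)))
      (bigPar n fun i => (M i).tensor (N i)) := by
  apply Le.of_dual
  refine (Le.ofIso (bigPar_dual n _)).trans ?_
  have h := Le.pDown n P e (fun i => (M i).dual) (fun i => (N i).dual)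
  have e1 : (fun i => ((M i).tensor (N i)).dual) = fun i => (M i).dual.par (N i).dual :=
    funext fun i => tensor_dual _ _
  rw [e1, tensor_dual]
  refine h.trans ?_
  have e2 : (P.comp fun v => M (e v)).dual = P.dual.comp fun v => (M (e v)).dual := comp_dual P _
  have e3 : (P.dual.comp fun v => N (e v)).dual = P.dual.dual.comp fun v => (N (e v)).dual :=
    comp_dual P.dual _
  rw [e2, e3]
  refine Le.parR _ (Le.ofIso ?_)
  exact comp_equiv P P.dual.dual (Equiv.refl _) (fun v w => by
    change P.adj v w ↔ (v ≠ w ∧ ¬ (v ≠ w ∧ ¬ P.adj v w))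
    constructor
    · intro h
      exact ⟨fun e => P.irrefl v (by rw [← e] at h; exact h), fun h' => h'.2 h⟩
    · rintro ⟨h, h'⟩
      by_contra h''
      exact h' ⟨h, h''⟩) (fun v => (N (e v)).dual)

theorem Le.rule {X Y : LGraph} (h : SGSRule X Y) : Le X Y := by
  rcases h with h | h
  · cases h with
    | ai a =>
      have := Le.ax (single a)
      rw [single_dual] at this
      exact this
    | ss A B S _ _ => exact Le.ss B A S
    | p n P e M N _ _ _ => exact Le.pDown n P e M N
  · cases h with
    | ai a =>
      have := Le.cut (single a)
      rw [single_dual] at this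
      exact this
    | ss A B S _ _ => exact Le.ssUp B A S
    | p n P e M N _ _ _ => exact Le.pUp n P e M N

theorem Le.deriv {X Y : LGraph} (h : Deriv SGSRule X Y) : Le X Y := by
  induction h with
  | refl => exact Le.refl _
  | tail _ h ih =>
    refine ih.trans ?_
    rcases h with h | ⟨C, R, p, c, hr, h1, h2⟩
    · exact Le.ofIso h
    · exact (Le.ofIso h1).trans ((Le.plug C R (Le.rule hr)).trans (Le.ofIso (iso_symm h2)))

theorem TT_self (H : LGraph) : TT H (mk H.dual) := by
  have h := (good H.toLG Set.univ).truth H Set.univ id (fun q => single (dualAtom (H.label q)))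
    (Set.image_id _) (fun _ _ _ _ _ => Iff.rfl) (fun _ _ => ⟨()⟩) (fun q _ => ?_)
  · exact T_cast h (mk_eq (comp_single_iso H.dual))
  · have e : fib (Set.univ : Set H.V) id q = {q} := by
      ext x
      constructor
      · rintro ⟨_, h⟩
        exact h
      · intro h
        exact ⟨trivial, h⟩
    rw [e, T_single]
    exact le_rfl

theorem sound {G : LGraph} (h : Provable SGSRule G) : Provable GSRule G := by
  have t : TT G 0 := by
    refine (Le.deriv h).pos 0 ?_
    exact (T_empty' (S := (Set.univ : Set LGraph.empty.V)) (by
      ext x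
      exact Empty.elim x)).mpr le_rfl
  have t' : TT G.dual (mk G) := by
    have := TT_self G.dual
    rwa [dual_dual] at this
  have := (good G.toLG Set.univ).orth t t'
  rw [zero_add] at this
  exact prov_iff.mp this

theorem complete {G : LGraph} (h : Provable GSRule G) : Provable SGSRule G := by
  refine Relation.ReflTransGen.mono (fun X Y hXY => ?_) _ _ h
  rcases hXY with h | ⟨C, R, p, c, hr, h1, h2⟩
  · exact Or.inl h
  · exact Or.inr ⟨C, R, p, c, Or.inl hr, h1, h2⟩

end final2
end part10

/-- For every graph `G`, `G` is provable in SGS if and only if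
`G` is provable in GS. -/
theorem sgs_iff_gs (G : LGraph) : Provable SGSRule G ↔ Provable GSRule G :=
  ⟨sound, complete⟩
end GSP
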